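/- Let F be a number field that is Galois over ℚ and let C > 1 be a real number. Then lim_{n→∞} (1/n)·log( ∏_{p} p ) = (C−1)/[F : ℚ], where the product runs over the prime numbers p with n ≤ p ≤ C·n that split completely in F. -/

import Mathlib

open scoped Classical

/-- A prime number `p` splits completely in a number field `F` if the number of ring
homomorphisms from the ring of integers of `F` (the integral closure of `ℤ` in `F`)
to `𝔽_p` equals the degree `[F : ℚ]`. -/
def SplitsCompletely (F : Type*) [Field F] [Algebra ℚ F] (p : ℕ) : Prop :=
  Nat.card ((integralClosure ℤ F) →+* ZMod p) = Module.finrank ℚ F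

/-- The product of the primes `p` with `n ≤ p ≤ C·n` that split completely in `F`. -/
noncomputable def splitPrimeProd (F : Type*) [Field F] [Algebra ℚ F] (C : ℝ) (n : ℕ) : ℝ :=
  ∏ p ∈ (Finset.range (⌈C * (n : ℝ)⌉₊ + 1)).filter
      (fun p : ℕ => p.Prime ∧ (n : ℝ) ≤ (p : ℝ) ∧ (p : ℝ) ≤ C * (n : ℝ) ∧ SplitsCompletely F p),
    (p : ℝ)

namespace Tauberian
open Filter Topology MeasureTheory Set Complex

/-- The Fejér kernel, as the cosine transform of a triangle. -/
noncomputable def fejer (u : ℝ) : ℝ := ∫ y in (0 : ℝ)..1, 2 * (1 - y) * Real.cos (u * y)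

theorem fejer_eq {u : ℝ} (hu : u ≠ 0) : fejer u = 2 * (1 - Real.cos u) / u ^ 2 := by
  have key : ∀ y ∈ uIcc (0 : ℝ) 1, HasDerivAt
      (fun y => 2 * ((1 - y) * Real.sin (u * y) / u - Real.cos (u * y) / u ^ 2))
      (2 * (1 - y) * Real.cos (u * y)) y := by
    intro y _
    have h1 : HasDerivAt (fun y : ℝ => u * y) u y := by
      simpa using (hasDerivAt_id y).const_mul u
    have h2 : HasDerivAt (fun y : ℝ => 1 - y) (-1) y := by
      simpa using (hasDerivAt_id y).const_sub 1
    refine (((h2.mul h1.sin).div_const u).sub (h1.cos.div_const (u ^ 2))).const_mul 2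
      |>.congr_deriv ?_
    field_simp
    ring
  rw [fejer, intervalIntegral.integral_eq_sub_of_hasDerivAt key
    (Continuous.intervalIntegrable (by fun_prop) _ _)]
  simp
  field_simp
  ring

theorem fejer_nonneg (u : ℝ) : 0 ≤ fejer u := by
  rcases eq_or_ne u 0 with rfl | hu
  · refine intervalIntegral.integral_nonneg zero_le_one fun y hy => ?_
    simp only [zero_mul, Real.cos_zero, mul_one]
    linarith [hy.2]
  · rw [fejer_eq hu]
    have := Real.cos_le_one u
    positivity [sub_nonneg.2 this]

theorem continuous_fejer : Continuous fejer := by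
  unfold fejer
  apply intervalIntegral.continuous_parametric_intervalIntegral_of_continuous'
  fun_prop

theorem fejer_zero : fejer 0 = 1 := by
  have : (∫ y in (0 : ℝ)..1, (1 - y)) = 1 / 2 := by
    rw [intervalIntegral.integral_sub (by simp) (by simp)]
    simp
    norm_num
  simp [fejer, this]

theorem fejer_le (u : ℝ) : fejer u ≤ 5 * (1 + u ^ 2)⁻¹ := by
  have h1 : fejer u ≤ 1 := by
    rw [← fejer_zero]
    refine intervalIntegral.integral_mono_on zero_le_one
      (Continuous.intervalIntegrable (by fun_prop) _ _)
      (Continuous.intervalIntegrable (by fun_prop) _ _) fun y hy => ?_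
    have := Real.cos_le_one (u * y)
    simp only [zero_mul, Real.cos_zero]
    nlinarith [hy.2]
  have h2 : u ^ 2 * fejer u ≤ 4 := by
    rcases eq_or_ne u 0 with rfl | hu
    · simp
    · rw [fejer_eq hu]
      have := Real.neg_one_le_cos u
      field_simp
      linarith
  rw [← div_eq_mul_inv, le_div_iff₀ (by positivity)]
  linarith

theorem integrable_fejer : Integrable fejer := by
  refine (integrable_inv_one_add_sq.const_mul 5).mono' continuous_fejer.aestronglyMeasurable ?_
  refine Eventually.of_forall fun u => ?_
  rw [Real.norm_of_nonneg (fejer_nonneg u)]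
  exact fejer_le u

theorem integral_fejer_pos : 0 < ∫ u, fejer u := by
  refine integral_pos_of_integrable_nonneg_nonzero (x := 0) continuous_fejer integrable_fejer
    fejer_nonneg ?_
  simp [fejer_zero]

theorem fejer_eq_integral_exp (u : ℝ) :
    (fejer u : ℂ) = ∫ y in (-1 : ℝ)..1, ((1 - |y| : ℝ) : ℂ) * cexp (I * (u * y)) := by
  have hc : ∀ a b : ℝ, IntervalIntegrable
      (fun y : ℝ => ((1 - |y| : ℝ) : ℂ) * cexp (I * (u * y))) volume a b := fun a b =>
    Continuous.intervalIntegrable (by fun_prop) _ _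
  rw [← intervalIntegral.integral_add_adjacent_intervals (hc (-1) 0) (hc 0 1)]
  have : ∫ y in (-1 : ℝ)..0, ((1 - |y| : ℝ) : ℂ) * cexp (I * (u * y)) =
      ∫ y in (0 : ℝ)..1, ((1 - |y| : ℝ) : ℂ) * cexp (-(I * (u * y))) := by
    have := intervalIntegral.integral_comp_neg (a := 0) (b := 1)
      (fun y : ℝ => ((1 - |y| : ℝ) : ℂ) * cexp (I * (u * y)))
    rw [neg_zero] at this
    rw [← this]
    simp
  rw [this, ← intervalIntegral.integral_add
    (Continuous.intervalIntegrable (by fun_prop) _ _) (hc 0 1), fejer,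
    ← intervalIntegral.integral_ofReal]
  refine intervalIntegral.integral_congr fun y hy => ?_
  rw [uIcc_of_le zero_le_one] at hy
  simp only [abs_of_nonneg hy.1]
  push_cast
  rw [Complex.cos]
  ring_nf

end Tauberian

namespace Tauberian
open Filter Topology MeasureTheory Set Complex

theorem integral_mul_fejer_eq {H : ℝ → ℝ} (hH : Measurable H) {M : ℝ} (hM : ∀ t, |H t| ≤ M)
    {ε : ℝ} (hε : 0 < ε) (l x : ℝ) :
    ((∫ t in Ioi (0 : ℝ), H t * Real.exp (-ε * t) * fejer (l * (x - t)) : ℝ) : ℂ) =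
      ∫ y in (-1 : ℝ)..1, ((1 - |y| : ℝ) : ℂ) * cexp (I * (l * x * y)) *
        ∫ t in Ioi (0 : ℝ), (H t : ℂ) * cexp (-((ε + l * y * I) * t)) := by
  rw [← integral_complex_ofReal]
  simp only [ofReal_mul, fejer_eq_integral_exp, intervalIntegral.integral_of_le
    (show (-1 : ℝ) ≤ 1 by norm_num), ← integral_const_mul]
  rw [integral_integral_swap]
  · refine integral_congr_ae (Eventually.of_forall fun y => ?_)
    refine integral_congr_ae (Eventually.of_forall fun t => ?_)
    simp only [ofReal_exp]
    rw [show -((ε + l * y * I : ℂ) * t) = ((-ε * t : ℝ) : ℂ) + -(l * y * I * t) by push_cast; ring,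
      Complex.exp_add,
      show I * ((l * ((x - t : ℝ) : ℂ)) * y) = I * (l * x * y) + -(l * y * I * t) by
        push_cast; ring, Complex.exp_add]
    ring
  · have h1 : Integrable (fun t => M * Real.exp (-ε * t)) (volume.restrict (Ioi 0)) :=
      (integrableOn_exp_mul_Ioi (by linarith) 0).const_mul M
    have h2 : Integrable (fun _ : ℝ => (1 : ℝ)) (volume.restrict (Ioc (-1 : ℝ) 1)) :=
      integrable_const _
    refine (h1.mul_prod h2).mono' ?_ ?_
    · refine Measurable.aestronglyMeasurable ?_
      unfold Function.uncurry
      fun_prop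
    · rw [Measure.prod_restrict]
      refine (ae_restrict_iff' (measurableSet_Ioi.prod measurableSet_Ioc)).2
        (Eventually.of_forall fun p hp => ?_)
      obtain ⟨-, hp⟩ := hp
      have h3 : |p.2| ≤ 1 := abs_le.2 ⟨hp.1.le, hp.2⟩
      have h4 : ‖cexp (I * ((l * ((x - p.1 : ℝ) : ℂ)) * p.2))‖ = 1 := by
        rw [mul_comm, ← ofReal_mul, ← ofReal_mul, norm_exp_ofReal_mul_I]
      simp only [Function.uncurry, norm_mul, h4, Complex.norm_real, Real.norm_eq_abs, Real.abs_exp,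
        mul_one]
      have h5 : |1 - abs p.2| ≤ 1 := by
        rw [abs_of_nonneg (by linarith)]
        linarith [abs_nonneg p.2]
      have := hM p.1
      have hM0 : 0 ≤ M := (abs_nonneg _).trans this
      calc _ ≤ M * Real.exp (-ε * p.1) * 1 := by gcongr
        _ = _ := by ring

theorem integrableOn_fejer_comp {l : ℝ} (hl : 0 < l) (x : ℝ) (s : Set ℝ) :
    IntegrableOn (fun t => fejer (l * (x - t))) s := by
  have h1 : Integrable (fun t => fejer (l * t)) := integrable_fejer.comp_mul_left' hl.ne'
  exact (h1.comp_sub_left x).integrableOn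

theorem integral_fejer_comp {l : ℝ} (hl : 0 < l) (x : ℝ) :
    ∫ t, fejer (l * (x - t)) = l⁻¹ * ∫ u, fejer u := by
  rw [integral_sub_left_eq_self (fun t => fejer (l * t)) volume x,
    Measure.integral_comp_mul_left, abs_of_pos (by positivity), smul_eq_mul]

/-- If the Laplace transform of a bounded function extends continuously to the closed half plane,
then the Fejér means of the function tend to zero. -/
theorem tendsto_integral_mul_fejer {H : ℝ → ℝ} (hH : Measurable H) {M : ℝ} (hM : ∀ t, |H t| ≤ M)
    {G : ℂ → ℂ} (hG : ContinuousOn G {z | 0 ≤ z.re})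
    (hGH : ∀ z : ℂ, 0 < z.re → ∫ t in Ioi (0 : ℝ), (H t : ℂ) * cexp (-(z * t)) = G z)
    {l : ℝ} (hl : 0 < l) :
    Tendsto (fun x => ∫ t in Ioi (0 : ℝ), H t * fejer (l * (x - t))) atTop (𝓝 0) := by
  have hM0 : 0 ≤ M := (abs_nonneg _).trans (hM 0)
  have key : ∀ x : ℝ, ((∫ t in Ioi (0 : ℝ), H t * fejer (l * (x - t)) : ℝ) : ℂ) =
      ∫ y in (-1 : ℝ)..1, ((1 - |y| : ℝ) : ℂ) * cexp (I * (l * x * y)) * G (l * y * I) := by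
    intro x
    have L : Tendsto (fun ε : ℝ => ∫ t in Ioi (0 : ℝ),
        H t * Real.exp (-ε * t) * fejer (l * (x - t))) (𝓝[>] 0)
        (𝓝 (∫ t in Ioi (0 : ℝ), H t * fejer (l * (x - t)))) := by
      refine tendsto_integral_filter_of_dominated_convergence (fun t => M * fejer (l * (x - t)))
        (Eventually.of_forall fun ε => ?_) ?_ ((integrableOn_fejer_comp hl x _).const_mul M) ?_
      · have := continuous_fejer
        exact Measurable.aestronglyMeasurable (by fun_prop)
      · filter_upwards [self_mem_nhdsWithin] with ε hε
        refine (ae_restrict_iff' measurableSet_Ioi).2 (Eventually.of_forall fun t ht => ?_)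
        rw [norm_mul, norm_mul, Real.norm_of_nonneg (fejer_nonneg _), Real.norm_eq_abs,
          Real.norm_of_nonneg (Real.exp_pos _).le]
        have h1 : Real.exp (-ε * t) ≤ 1 := Real.exp_le_one_iff.2 (by
          have : 0 < ε * t := mul_pos hε ht
          linarith)
        have h2 := hM t
        have h3 := fejer_nonneg (l * (x - t))
        calc _ ≤ M * 1 * fejer (l * (x - t)) := by gcongr
          _ = _ := by ring
      · refine Eventually.of_forall fun t => ?_
        have : Continuous fun ε : ℝ => H t * Real.exp (-ε * t) * fejer (l * (x - t)) := by fun_prop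
        simpa using (this.tendsto 0).mono_left nhdsWithin_le_nhds
    have L2 := (continuous_ofReal.tendsto _).comp L
    refine tendsto_nhds_unique L2 ?_
    have hK : IsCompact (Icc (0 : ℝ) 1 ×ˢ Icc (-1 : ℝ) 1) := isCompact_Icc.prod isCompact_Icc
    have hGc : ContinuousOn (fun p : ℝ × ℝ => G (p.1 + l * p.2 * I)) {p | 0 ≤ p.1} := by
      refine hG.comp (by fun_prop) fun p hp => ?_
      simpa using hp
    obtain ⟨B, hB⟩ := (hK.image_of_continuousOn
      (hGc.mono fun p hp => hp.1.1)).isBounded.exists_norm_le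
    have : ∀ᶠ ε : ℝ in 𝓝[>] 0, (∫ y in (-1 : ℝ)..1, ((1 - |y| : ℝ) : ℂ) *
        cexp (I * (l * x * y)) * G (ε + l * y * I)) =
        ((∫ t in Ioi (0 : ℝ), H t * Real.exp (-ε * t) * fejer (l * (x - t)) : ℝ) : ℂ) := by
      filter_upwards [self_mem_nhdsWithin] with ε hε
      rw [integral_mul_fejer_eq hH hM hε]
      refine intervalIntegral.integral_congr fun y _ => ?_
      rw [hGH _ (by simpa using hε)]
    refine Tendsto.congr' this ?_
    have hmem : ∀ᶠ ε : ℝ in 𝓝[>] 0, ε ∈ Ioc (0 : ℝ) 1 := Ioc_mem_nhdsGT zero_lt_one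
    refine intervalIntegral.tendsto_integral_filter_of_dominated_convergence (fun _ => B) ?_ ?_
      (by simp) ?_
    · filter_upwards [self_mem_nhdsWithin] with ε hε
      refine Continuous.aestronglyMeasurable ?_
      refine Continuous.mul (by fun_prop) ?_
      exact hG.comp_continuous (by fun_prop) fun y => by simpa using (le_of_lt hε)
    · filter_upwards [hmem] with ε hε
      refine Eventually.of_forall fun y hy => ?_
      rw [uIoc_of_le (by norm_num)] at hy
      have h4 : ‖cexp (I * (l * x * y))‖ = 1 := by
        rw [mul_comm, ← ofReal_mul, ← ofReal_mul, norm_exp_ofReal_mul_I]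
      have h3 : |y| ≤ 1 := abs_le.2 ⟨hy.1.le, hy.2⟩
      have h5 : |1 - abs y| ≤ 1 := by
        rw [abs_of_nonneg (by linarith)]
        linarith [abs_nonneg y]
      have h6 : ‖G (ε + l * y * I)‖ ≤ B :=
        hB _ ⟨(ε, y), ⟨⟨hε.1.le, hε.2⟩, hy.1.le, hy.2⟩, rfl⟩
      rw [norm_mul, norm_mul, h4, Complex.norm_real, Real.norm_eq_abs]
      calc _ ≤ 1 * 1 * B := by gcongr
        _ = B := by ring
    · refine Eventually.of_forall fun y _ => ?_
      refine Tendsto.const_mul _ ?_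
      have h7 : ContinuousWithinAt (fun ε : ℝ => G (ε + l * y * I)) (Ici 0) 0 :=
        (hG.comp (s := Ici (0 : ℝ)) (f := fun ε : ℝ => (ε + l * y * I : ℂ)) (by fun_prop)
          fun ε hε => by simpa using hε) 0 self_mem_Ici
      simpa using h7.tendsto.mono_left (nhdsWithin_mono _ Ioi_subset_Ici_self)
  have RL := Real.tendsto_integral_exp_smul_cocompact
    (fun y => (Ioc (-1 : ℝ) 1).indicator (fun y : ℝ => ((1 - |y| : ℝ) : ℂ) * G (l * y * I)) y)
  have h8 : Tendsto (fun x : ℝ => -(l * x / (2 * Real.pi))) atTop (cocompact ℝ) := by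
    have : Tendsto (fun x : ℝ => -(l * x / (2 * Real.pi))) atTop atBot := by
      refine tendsto_neg_atTop_atBot.comp ?_
      exact (tendsto_id.const_mul_atTop hl).atTop_div_const (by positivity)
    exact this.mono_right atBot_le_cocompact
  have h9 := RL.comp h8
  have h10 : Tendsto (fun x => ((∫ t in Ioi (0 : ℝ), H t * fejer (l * (x - t)) : ℝ) : ℂ))
      atTop (𝓝 0) := by
    refine h9.congr fun x => ?_
    rw [key, intervalIntegral.integral_of_le (by norm_num), ← integral_indicator measurableSet_Ioc]
    refine integral_congr_ae (Eventually.of_forall fun y => ?_)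
    by_cases hy : y ∈ Ioc (-1 : ℝ) 1
    · simp only [indicator_of_mem hy]
      rw [Circle.smul_def, Real.fourierChar_apply, smul_eq_mul]
      have : ((2 * Real.pi * -(y * -(l * x / (2 * Real.pi))) : ℝ) : ℂ) * I = I * (l * x * y) := by
        have : 2 * Real.pi * -(y * -(l * x / (2 * Real.pi))) = l * x * y := by
          field_simp
        rw [this]
        push_cast
        ring
      rw [this]
      ring
    · simp [indicator_of_notMem hy]
  exact_mod_cast (continuous_re.tendsto _).comp h10
end Tauberian

namespace Tauberian
open Filter Topology MeasureTheory Set Complex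

theorem tendsto_setIntegral_fejer :
    Tendsto (fun r : ℝ => ∫ u in Icc (-r) r, fejer u) atTop (𝓝 (∫ u, fejer u)) :=
  (aecover_Icc tendsto_neg_atTop_atBot tendsto_id).integral_tendsto_of_countably_generated
    integrable_fejer

theorem setIntegral_fejer_comp {l : ℝ} (hl : 0 < l) (x δ : ℝ) :
    ∫ t in Icc (x - δ) (x + δ), fejer (l * (x - t)) =
      l⁻¹ * ∫ u in Icc (-(l * δ)) (l * δ), fejer u := by
  rcases lt_or_ge δ 0 with h | hδ
  · rw [Icc_eq_empty (by linarith), Icc_eq_empty (by nlinarith)]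
    simp
  rw [integral_Icc_eq_integral_Ioc, integral_Icc_eq_integral_Ioc,
    ← intervalIntegral.integral_of_le (by linarith),
    ← intervalIntegral.integral_of_le (by nlinarith),
    intervalIntegral.integral_comp_sub_left (fun t => fejer (l * t)),
    intervalIntegral.integral_comp_mul_left _ hl.ne', smul_eq_mul]
  ring_nf

theorem tendsto_setIntegral_fejer_comp {l : ℝ} (hl : 0 < l) :
    Tendsto (fun x => ∫ t in Ioi (0 : ℝ), fejer (l * (x - t))) atTop
      (𝓝 (l⁻¹ * ∫ u, fejer u)) := by
  have h1 : Integrable (fun t => fejer (l * t)) := integrable_fejer.comp_mul_left' hl.ne'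
  have h2 := (aecover_Iio tendsto_id).integral_tendsto_of_countably_generated h1
  rw [Measure.integral_comp_mul_left, abs_of_pos (by positivity), smul_eq_mul] at h2
  refine h2.congr fun x => ?_
  have h3 := (Measure.measurePreserving_sub_left volume x).setIntegral_preimage_emb
    (Homeomorph.subLeft x).measurableEmbedding (fun t => fejer (l * t)) (Iio x)
  simp only [preimage_const_sub_Iio, sub_self] at h3
  exact h3.symm

/-- A Tauberian theorem of Wiener-Ikehara type. -/
theorem tendsto_of_laplace_extends {B : ℝ → ℝ} (hB : Measurable B) (hB0 : ∀ t, 0 ≤ B t) {M : ℝ}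
    (hM : ∀ t, B t ≤ M) (hmono : Monotone fun t => B t * Real.exp t) {A : ℝ}
    {G : ℂ → ℂ} (hG : ContinuousOn G {z | 0 ≤ z.re})
    (hGB : ∀ z : ℂ, 0 < z.re →
      ∫ t in Ioi (0 : ℝ), ((B t - A : ℝ) : ℂ) * cexp (-(z * t)) = G z) :
    Tendsto B atTop (𝓝 A) := by
  set c := ∫ u, fejer u with hc
  have hc0 : 0 < c := integral_fejer_pos
  have hM0 : 0 ≤ M := (hB0 0).trans (hM 0)
  have hInt : ∀ {l : ℝ}, 0 < l → ∀ x : ℝ, ∀ s : Set ℝ,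
      IntegrableOn (fun t => B t * fejer (l * (x - t))) s := by
    intro l hl x s
    refine ((integrableOn_fejer_comp hl x s).const_mul M).mono' ?_ ?_
    · have := continuous_fejer
      exact Measurable.aestronglyMeasurable (by fun_prop)
    · refine Eventually.of_forall fun t => ?_
      rw [Real.norm_of_nonneg (mul_nonneg (hB0 t) (fejer_nonneg _))]
      exact mul_le_mul_of_nonneg_right (hM t) (fejer_nonneg _)
  have hJ : ∀ {l : ℝ}, 0 < l → Tendsto
      (fun x => ∫ t in Ioi (0 : ℝ), B t * fejer (l * (x - t))) atTop (𝓝 (A * (l⁻¹ * c))) := by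
    intro l hl
    have h1 := tendsto_integral_mul_fejer (H := fun t => B t - A) (by fun_prop) (M := M + |A|)
      (fun t => by
        rw [abs_sub_comm]
        calc |A - B t| ≤ |A| + |B t| := abs_sub _ _
          _ ≤ M + |A| := by rw [abs_of_nonneg (hB0 t)]; linarith [hM t]) hG hGB hl
    have h2 := h1.add ((tendsto_setIntegral_fejer_comp hl).const_mul A)
    rw [zero_add] at h2
    refine h2.congr fun x => ?_
    rw [← integral_const_mul, ← integral_add]
    · exact integral_congr_ae (Eventually.of_forall fun t => by ring)
    · have := (hInt hl x (Ioi 0)).sub ((integrableOn_fejer_comp hl x (Ioi 0)).const_mul A)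
      exact this.congr (Eventually.of_forall fun t => by simp; ring)
    · exact (integrableOn_fejer_comp hl x (Ioi 0)).const_mul A
  have hbound : ∀ {η : ℝ}, 0 < η → η < 1 → ∀ᶠ x in atTop,
      B x ≤ (A + η) * Real.exp (2 * η) / (1 - η) ∧
        (A - η - M * η) * Real.exp (-(2 * η)) ≤ B x := by
    intro η hη hη1
    have hr : ∀ᶠ r in atTop, (1 - η) * c < ∫ u in Icc (-r) r, fejer u :=
      tendsto_setIntegral_fejer.eventually_const_lt (by nlinarith)
    obtain ⟨r, hr, hr0⟩ := (hr.and (eventually_gt_atTop 0)).exists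
    set l := r / η with hl
    have hl0 : 0 < l := by positivity
    have hlη : l * η = r := by rw [hl]; field_simp
    set w := ∫ u in Icc (-r) r, fejer u with hw
    have hwc : w ≤ c := setIntegral_le_integral integrable_fejer
      (Eventually.of_forall fejer_nonneg)
    have hw0 : 0 < w := lt_of_le_of_lt (by nlinarith) hr
    have hwin : ∀ x, ∫ t in Icc (x - η) (x + η), fejer (l * (x - t)) = l⁻¹ * w := by
      intro x
      rw [setIntegral_fejer_comp hl0, hlη]
    have hE1 : ∀ᶠ x in atTop, ∫ t in Ioi (0 : ℝ), B t * fejer (l * (x - t)) <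
        (A + η) * (l⁻¹ * c) := (hJ hl0).eventually_lt_const (by
          have : 0 < l⁻¹ * c := by positivity
          nlinarith)
    have hE2 : ∀ᶠ x in atTop, (A - η) * (l⁻¹ * c) <
        ∫ t in Ioi (0 : ℝ), B t * fejer (l * (x - t)) := (hJ hl0).eventually_const_lt (by
          have : 0 < l⁻¹ * c := by positivity
          nlinarith)
    have hup : ∀ᶠ x in atTop, B (x - η) ≤ (A + η) * Real.exp (2 * η) / (1 - η) := by
      filter_upwards [hE1, eventually_gt_atTop η] with x hx hxη
      have h1 : B (x - η) * Real.exp (-(2 * η)) * (l⁻¹ * w) ≤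
          ∫ t in Ioi (0 : ℝ), B t * fejer (l * (x - t)) := by
        rw [← hwin x, ← integral_const_mul]
        refine le_trans ?_ (setIntegral_mono_set (hInt hl0 x (Ioi 0))
          (Eventually.of_forall fun t => mul_nonneg (hB0 t) (fejer_nonneg _))
          (LE.le.eventuallyLE
            (show Icc (x - η) (x + η) ≤ Ioi 0 from fun t ht => lt_of_lt_of_le (by linarith) ht.1)))
        refine setIntegral_mono_on ((integrableOn_fejer_comp hl0 x _).const_mul _)
          (hInt hl0 x _) measurableSet_Icc fun t ht => ?_
        refine mul_le_mul_of_nonneg_right ?_ (fejer_nonneg _)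
        have h2 := hmono ht.1
        simp only at h2
        have h3 : B (x - η) * Real.exp (x - η) ≤ B t * Real.exp (x + η) :=
          h2.trans (mul_le_mul_of_nonneg_left (Real.exp_le_exp.2 ht.2) (hB0 t))
        rw [show x + η = 2 * η + (x - η) by ring, Real.exp_add, ← mul_assoc] at h3
        have h4 := le_of_mul_le_mul_right h3 (Real.exp_pos _)
        rwa [Real.exp_neg, ← div_eq_mul_inv, div_le_iff₀ (Real.exp_pos _)]
      have h5 : B (x - η) * Real.exp (-(2 * η)) * w < (A + η) * c := by
        have := h1.trans_lt hx
        have h6 : l⁻¹ * (B (x - η) * Real.exp (-(2 * η)) * w) < l⁻¹ * ((A + η) * c) := by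
          linarith
        exact lt_of_mul_lt_mul_left h6 (by positivity)
      have h7 : B (x - η) * Real.exp (-(2 * η)) * ((1 - η) * c) ≤ (A + η) * c :=
        le_trans (mul_le_mul_of_nonneg_left hr.le
          (mul_nonneg (hB0 _) (Real.exp_pos _).le)) h5.le
      have h8 : B (x - η) * Real.exp (-(2 * η)) * (1 - η) ≤ A + η := by
        refine le_of_mul_le_mul_right ?_ hc0
        linarith
      rw [le_div_iff₀ (by linarith)]
      rw [Real.exp_neg] at h8
      have := mul_le_mul_of_nonneg_right h8 (Real.exp_pos (2 * η)).le
      have h9 := (Real.exp_pos (2 * η)).ne'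
      calc _ = B (x - η) * (Real.exp (2 * η))⁻¹ * (1 - η) * Real.exp (2 * η) := by field_simp
        _ ≤ _ := this
    have hlow : ∀ᶠ x in atTop, (A - η - M * η) * Real.exp (-(2 * η)) ≤ B (x + η) := by
      filter_upwards [hE2] with x hx
      have h1 : ∫ t in Ioi (0 : ℝ), B t * fejer (l * (x - t)) ≤
          B (x + η) * Real.exp (2 * η) * (l⁻¹ * w) + M * (l⁻¹ * c - l⁻¹ * w) := by
        refine (setIntegral_le_integral (integrableOn_univ.1 (hInt hl0 x univ))
          (Eventually.of_forall fun t => mul_nonneg (hB0 t) (fejer_nonneg _))).trans ?_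
        have hcompl : ∫ t in (Icc (x - η) (x + η))ᶜ, fejer (l * (x - t)) = l⁻¹ * c - l⁻¹ * w := by
          have := integral_add_compl (measurableSet_Icc (a := x - η) (b := x + η))
            (integrableOn_univ.1 (integrableOn_fejer_comp hl0 x univ))
          rw [hwin, integral_fejer_comp hl0] at this
          linarith
        rw [← integral_add_compl (measurableSet_Icc (a := x - η) (b := x + η))
          (integrableOn_univ.1 (hInt hl0 x univ)), ← hcompl, ← hwin x, ← integral_const_mul,
          ← integral_const_mul]
        refine add_le_add ?_ ?_
        · refine setIntegral_mono_on (hInt hl0 x _)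
            ((integrableOn_fejer_comp hl0 x _).const_mul _) measurableSet_Icc fun t ht => ?_
          refine mul_le_mul_of_nonneg_right ?_ (fejer_nonneg _)
          have h2 := hmono ht.2
          simp only at h2
          have h3 : B t * Real.exp (x - η) ≤ B (x + η) * Real.exp (x + η) :=
            (mul_le_mul_of_nonneg_left (Real.exp_le_exp.2 ht.1) (hB0 t)).trans h2
          rw [show x + η = 2 * η + (x - η) by ring, Real.exp_add, ← mul_assoc,
            show 2 * η + (x - η) = x + η by ring] at h3
          exact le_of_mul_le_mul_right h3 (Real.exp_pos _)
        · refine setIntegral_mono_on (hInt hl0 x _)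
            ((integrableOn_fejer_comp hl0 x _).const_mul _) measurableSet_Icc.compl fun t ht => ?_
          exact mul_le_mul_of_nonneg_right (hM t) (fejer_nonneg _)
      have h2 : (A - η) * c < B (x + η) * Real.exp (2 * η) * w + M * (c - w) := by
        have h6 : l⁻¹ * ((A - η) * c) <
            l⁻¹ * (B (x + η) * Real.exp (2 * η) * w + M * (c - w)) := by
          linarith
        exact lt_of_mul_lt_mul_left h6 (by positivity)
      have h3 : B (x + η) * Real.exp (2 * η) * w ≤ B (x + η) * Real.exp (2 * η) * c :=
        mul_le_mul_of_nonneg_left hwc (mul_nonneg (hB0 _) (Real.exp_pos _).le)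
      have h4 : M * (c - w) ≤ M * (η * c) :=
        mul_le_mul_of_nonneg_left (by linarith) hM0
      have h5 : A - η - M * η ≤ B (x + η) * Real.exp (2 * η) := by
        refine le_of_mul_le_mul_right ?_ hc0
        linarith
      rwa [Real.exp_neg, ← div_eq_mul_inv, div_le_iff₀ (Real.exp_pos _)]
    have hup' := (tendsto_atTop_add_const_right atTop η tendsto_id).eventually hup
    have hlow' := (tendsto_atTop_add_const_right atTop (-η) tendsto_id).eventually hlow
    filter_upwards [hup', hlow'] with x h1 h2
    simp only [id, add_sub_cancel_right, neg_add_cancel_right] at h1 h2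
    exact ⟨h1, h2⟩
  have hη : ∀ᶠ η : ℝ in 𝓝[>] 0, η ∈ Ioo (0 : ℝ) 1 := Ioo_mem_nhdsGT zero_lt_one
  refine tendsto_order.2 ⟨fun a ha => ?_, fun a ha => ?_⟩
  · have h1 : Tendsto (fun η : ℝ => (A - η - M * η) * Real.exp (-(2 * η))) (𝓝[>] 0) (𝓝 A) := by
      have : Continuous fun η : ℝ => (A - η - M * η) * Real.exp (-(2 * η)) := by fun_prop
      simpa using (this.tendsto 0).mono_left nhdsWithin_le_nhds
    obtain ⟨η, hη1, hη2⟩ := ((h1.eventually_const_lt ha).and hη).exists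
    filter_upwards [hbound hη2.1 hη2.2] with x hx using hη1.trans_le hx.2
  · have h1 : Tendsto (fun η : ℝ => (A + η) * Real.exp (2 * η) / (1 - η)) (𝓝[>] 0) (𝓝 A) := by
      have : ContinuousAt (fun η : ℝ => (A + η) * Real.exp (2 * η) / (1 - η)) 0 :=
        ContinuousAt.div (by fun_prop) (by fun_prop) (by norm_num)
      simpa using this.tendsto.mono_left nhdsWithin_le_nhds
    obtain ⟨η, hη1, hη2⟩ := ((h1.eventually_lt_const ha).and hη).exists
    filter_upwards [hbound hη2.1 hη2.2] with x hx using hx.1.trans_lt hη1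
end Tauberian

namespace Tauberian
open Filter Topology MeasureTheory Set Complex

theorem integral_exp_substitution (f : ℝ → ℂ) :
    ∫ x in Ioi (1 : ℝ), f x = ∫ t in Ioi (0 : ℝ), (Real.exp t : ℂ) * f (Real.exp t) := by
  have h1 : Real.exp '' Ioi 0 = Ioi 1 := by
    ext x
    constructor
    · rintro ⟨t, ht, rfl⟩
      exact Real.one_lt_exp_iff.2 ht
    · intro hx
      exact ⟨Real.log x, Real.log_pos hx, Real.exp_log (zero_lt_one.trans hx)⟩
  rw [← h1, integral_image_eq_integral_abs_deriv_smul measurableSet_Ioi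
    (fun t _ => (Real.hasDerivAt_exp t).hasDerivWithinAt) Real.exp_injective.injOn]
  refine setIntegral_congr_fun measurableSet_Ioi fun t _ => ?_
  simp [abs_of_pos (Real.exp_pos t)]

/-- **Wiener-Ikehara theorem**, for Dirichlet series whose partial sums are `O(x)`. -/
theorem tendsto_sum_div_of_LSeries {a : ℕ → ℝ} (ha : ∀ n, 0 ≤ a n) {M : ℝ}
    (hM : ∀ n : ℕ, ∑ k ∈ Finset.Icc 1 n, a k ≤ M * n) {A : ℝ}
    (hlim : ∀ s₀ : ℂ, s₀.re = 1 → ∃ c, Tendsto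
      (fun s => LSeries (fun n => (a n : ℂ)) s - A / (s - 1)) (𝓝[{s | 1 < s.re}] s₀) (𝓝 c)) :
    Tendsto (fun x : ℝ => (∑ k ∈ Finset.Icc 1 ⌊x⌋₊, a k) / x) atTop (𝓝 A) := by
  set ψ : ℝ → ℝ := fun x => ∑ k ∈ Finset.Icc 1 ⌊x⌋₊, a k with hψ
  have hψ0 : ∀ x, 0 ≤ ψ x := fun x => Finset.sum_nonneg fun k _ => ha k
  have hψmono : Monotone ψ := fun x y hxy =>
    Finset.sum_le_sum_of_subset_of_nonneg
      (Finset.Icc_subset_Icc_right (Nat.floor_le_floor hxy)) fun k _ _ => ha k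
  have hM0 : 0 ≤ M := by
    have := (Finset.sum_nonneg fun k _ => ha k).trans (hM 1)
    simpa using this
  have hψM : ∀ x, 0 ≤ x → ψ x ≤ M * x := fun x hx =>
    (hM _).trans (mul_le_mul_of_nonneg_left (Nat.floor_le hx) hM0)
  set B : ℝ → ℝ := fun t => ψ (Real.exp t) * Real.exp (-t) with hB
  have hBmeas : Measurable B := by
    have := hψmono.measurable
    fun_prop
  have hBe : ∀ t, B t * Real.exp t = ψ (Real.exp t) := fun t => by
    simp only [hB]
    rw [mul_assoc, ← Real.exp_add]
    simp
  have hB0 : ∀ t, 0 ≤ B t := fun t => mul_nonneg (hψ0 _) (Real.exp_pos _).le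
  have hBM : ∀ t, B t ≤ M := fun t => by
    refine le_of_mul_le_mul_right ?_ (Real.exp_pos t)
    rw [hBe]
    exact hψM _ (Real.exp_pos t).le
  set F : ℂ → ℂ := fun s => LSeries (fun n => (a n : ℂ)) s - A / (s - 1) with hF
  set E := extendFrom {s : ℂ | 1 < s.re} F with hE
  have hopen : IsOpen {s : ℂ | 1 < s.re} := isOpen_lt continuous_const continuous_re
  have hO : (fun n ↦ ∑ k ∈ Finset.Icc 1 n, a k) =O[atTop] fun n ↦ (n : ℝ) ^ (1 : ℝ) := by
    refine Asymptotics.IsBigO.of_bound M (Eventually.of_forall fun n => ?_)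
    rw [Real.norm_of_nonneg (Finset.sum_nonneg fun k _ => ha k), Real.rpow_one,
      Real.norm_of_nonneg (Nat.cast_nonneg n)]
    exact hM n
  have hFcont : ContinuousOn F {s : ℂ | 1 < s.re} := by
    have hsum : ∀ s : ℂ, 1 < s.re → LSeriesSummable (fun n => (a n : ℂ)) s := by
      intro s hs
      refine LSeriesSummable_of_sum_norm_bigO (r := 1) ?_ zero_le_one hs
      simpa [abs_of_nonneg (ha _)] using hO
    have h1 : LSeries.abscissaOfAbsConv (fun n => (a n : ℂ)) ≤ 1 :=
      LSeries.abscissaOfAbsConv_le_of_forall_lt_LSeriesSummable fun y hy => hsum y (by simpa using hy)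
    refine ContinuousOn.sub ?_ ?_
    · refine (LSeries_differentiableOn _).continuousOn.mono fun s hs => ?_
      exact h1.trans_lt (by exact_mod_cast hs)
    · refine continuousOn_const.div (by fun_prop) fun s hs h => ?_
      have : s = 1 := by linear_combination h
      simp [this] at hs
  have hsub : {s : ℂ | 1 ≤ s.re} ⊆ closure {s : ℂ | 1 < s.re} := by
    rw [Complex.closure_setOfPred_lt_re]
  have hEcont : ContinuousOn E {s : ℂ | 1 ≤ s.re} := by
    refine continuousOn_extendFrom hsub fun s hs => ?_
    rcases eq_or_lt_of_le (show 1 ≤ s.re from hs) with h | h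
    · exact hlim s h.symm
    · exact ⟨F s, hFcont s h⟩
  have hEF : ∀ s : ℂ, 1 < s.re → E s = F s := fun s hs =>
    extendFrom_eq (subset_closure hs) (hFcont s hs)
  have hne : ∀ z : ℂ, 0 ≤ z.re → 1 + z ≠ 0 := fun z hz h => by
    have := congrArg re h
    simp at this
    linarith
  have key : Tendsto B atTop (𝓝 A) := by
    refine tendsto_of_laplace_extends hBmeas hB0 hBM ?_
      (G := fun z => E (1 + z) / (1 + z) - A / (1 + z)) ?_ ?_
    · intro s t hst
      simp only [hBe]
      exact hψmono (Real.exp_le_exp.2 hst)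
    · refine ContinuousOn.sub (ContinuousOn.div ?_ (by fun_prop) hne)
        (continuousOn_const.div (by fun_prop) hne)
      exact hEcont.comp (by fun_prop) fun z hz => by simpa using hz
    · intro z hz
      have hz0 : z ≠ 0 := fun h => by simp [h] at hz
      have hL := LSeries_eq_mul_integral_of_nonneg a zero_le_one (s := 1 + z) (by simpa using hz)
        hO ha
      rw [integral_exp_substitution] at hL
      have hInt : IntegrableOn (fun t : ℝ => cexp (-(z * t))) (Ioi 0) := by
        have := integrableOn_exp_mul_complex_Ioi (a := -z) (by simpa using hz) 0
        simpa using this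
      have hI : ∫ t in Ioi (0 : ℝ), cexp (-(z * t)) = 1 / z := by
        have := integral_exp_mul_complex_Ioi (a := -z) (by simpa using hz) 0
        simpa using this
      have hInt2 : IntegrableOn (fun t : ℝ => (B t : ℂ) * cexp (-(z * t))) (Ioi 0) := by
        refine (hInt.norm.const_mul M).mono' ?_ (Eventually.of_forall fun t => ?_)
        · exact Measurable.aestronglyMeasurable (by fun_prop)
        · rw [norm_mul, norm_real, Real.norm_of_nonneg (hB0 t)]
          exact mul_le_mul_of_nonneg_right (hBM t) (norm_nonneg _)
      have hL2 : LSeries (fun n => (a n : ℂ)) (1 + z) =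
          (1 + z) * ∫ t in Ioi (0 : ℝ), (B t : ℂ) * cexp (-(z * t)) := by
        rw [hL]
        congr 1
        refine setIntegral_congr_fun measurableSet_Ioi fun t _ => ?_
        simp only [hB, hψ]
        have h1 : (Real.exp t : ℂ) ^ (-(1 + z + 1)) = cexp (-t) * cexp (-t) * cexp (-(z * t)) := by
          rw [cpow_def_of_ne_zero (by exact_mod_cast (Real.exp_pos t).ne'), ← ofReal_log
            (Real.exp_pos t).le, Real.log_exp, ← Complex.exp_add, ← Complex.exp_add]
          ring_nf
        rw [h1]
        push_cast
        have h2 : cexp t * cexp (-t) = 1 := by rw [← Complex.exp_add]; simp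
        linear_combination ((∑ k ∈ Finset.Icc 1 ⌊Real.exp t⌋₊, (a k : ℂ)) * cexp (-t) *
          cexp (-(z * t))) * h2
      have hz1 := hne z hz.le
      rw [hEF _ (by simpa using hz)]
      simp only [hF, hL2, add_sub_cancel_left]
      simp only [ofReal_sub, sub_mul]
      rw [integral_sub hInt2 (hInt.const_mul _), integral_const_mul, hI]
      field_simp
      ring
  have := key.comp Real.tendsto_log_atTop
  refine this.congr' ?_
  filter_upwards [eventually_gt_atTop 0] with x hx
  simp only [Function.comp, hB, Real.exp_log hx, Real.exp_neg]
  rfl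
end Tauberian

namespace LatticeSum
open MeasureTheory Module Submodule Set Bornology

theorem abs_sum_sub_integral_le {E : Type*} [NormedAddCommGroup E] [NormedSpace ℝ E]
    [FiniteDimensional ℝ E] [MeasurableSpace E] [BorelSpace E] (μ : Measure E)
    [μ.IsAddHaarMeasure] {ι : Type*} [Fintype ι] (b : Basis ι ℝ E) {f : E → ℝ} {L : NNReal}
    (hf : LipschitzWith L f) {R : ℝ} (hR0 : 0 ≤ R) (hR : ∀ x, R < ‖x‖ → f x = 0) :
    ∃ M, ∀ t : ℝ, 1 ≤ t →
      |∑' v : span ℤ (range b), f (t⁻¹ • (v : E)) -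
        (∫ x, f x ∂μ) / μ.real (ZSpan.fundamentalDomain b) * t ^ finrank ℝ E|
        ≤ M * (t ^ finrank ℝ E / t) := by
  have : ProperSpace E := FiniteDimensional.proper ℝ E
  set P := ZSpan.fundamentalDomain b with hP
  set D := ∑ i, ‖b i‖ with hD
  have hD0 : 0 ≤ D := Finset.sum_nonneg fun _ _ => norm_nonneg _
  set d := finrank ℝ E with hd
  have hPD : ∀ x ∈ P, ‖x‖ ≤ D := by
    intro x hx
    rw [← ZSpan.fract_eq_self.mpr hx]
    exact ZSpan.norm_fract_le b x
  have hPm : MeasurableSet P := ZSpan.fundamentalDomain_measurableSet b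
  have hfund := ZSpan.isAddFundamentalDomain b μ
  have : VAddInvariantMeasure (span ℤ (range b)) E μ :=
    inferInstanceAs <| VAddInvariantMeasure (span ℤ (range b)).toAddSubgroup E μ
  have hPfin : μ P ≠ ⊤ := (ZSpan.fundamentalDomain_isBounded b).measure_lt_top.ne
  have hP0 : μ P ≠ 0 := ZSpan.measure_fundamentalDomain_ne_zero b
  have hPr : 0 < μ.real P := ENNReal.toReal_pos hP0 hPfin
  set B := μ.real (Metric.ball (0 : E) 1) with hB
  refine ⟨(L * D) * ((R + 2 * D + 1) ^ d * B) / μ.real P, fun t ht => ?_⟩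
  have ht0 : 0 < t := by linarith
  set φ : E → ℝ := fun x => f (t⁻¹ • x) with hφ
  have hφc : Continuous φ := hf.continuous.comp (continuous_const_smul _)
  have hφ0 : ∀ x, t * R < ‖x‖ → φ x = 0 := by
    intro x hx
    apply hR
    rw [norm_smul, norm_inv, Real.norm_of_nonneg ht0.le]
    rw [lt_inv_mul_iff₀ ht0]; exact hx
  have hφs : HasCompactSupport φ :=
    HasCompactSupport.intro (isCompact_closedBall (0 : E) (t * R)) fun x hx => by
      apply hφ0; simpa using hx
  have hφi : Integrable φ μ := hφc.integrable_of_hasCompactSupport hφs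
  have hInt : ∫ x, φ x ∂μ = t ^ d * ∫ x, f x ∂μ := by
    rw [hφ, Measure.integral_comp_inv_smul]
    simp [abs_of_pos (pow_pos ht0 _), hd]
  have hfin : Set.Finite {v : span ℤ (range b) | ‖(v : E)‖ ≤ t * R + D} := by
    have := ZSpan.setFinite_inter b (Metric.isBounded_closedBall (x := (0 : E)) (r := t * R + D))
    refine Set.Finite.of_finite_image (f := Subtype.val) (this.subset ?_) Subtype.val_injective.injOn
    rintro _ ⟨v, hv, rfl⟩
    exact ⟨by simpa using hv, v.2⟩
  set S := hfin.toFinset with hS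
  have hmem : ∀ v, v ∉ S → t * R + D < ‖(v : E)‖ := by
    intro v hv
    simpa [hS] using hv
  have hsum1 : ∑' v : span ℤ (range b), f (t⁻¹ • (v : E)) = ∑ v ∈ S, φ v := by
    refine tsum_eq_sum fun v hv => hφ0 _ ?_
    linarith [hmem v hv]
  have hsum2 : ∫ x, φ x ∂μ = ∑ v ∈ S, ∫ x in P, φ (v +ᵥ x) ∂μ := by
    rw [hfund.integral_eq_tsum'' φ hφi]
    refine tsum_eq_sum fun v hv => ?_
    refine (setIntegral_congr_fun hPm fun x hx => ?_).trans (integral_zero _ _)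
    apply hφ0
    have h1 := hmem v hv
    have h2 := hPD x hx
    have h3 : ‖(v : E)‖ ≤ ‖(v : E) + x‖ + ‖x‖ := by
      simpa using norm_sub_le ((v : E) + x) x
    have : (v +ᵥ x) = (v : E) + x := rfl
    rw [this]; linarith
  have hcard : (S.card : ℝ) * μ.real P ≤ ((R + 2 * D + 1) ^ d * B) * t ^ d := by
    have h1 : (S.card : ENNReal) * μ P ≤ μ (Metric.ball (0 : E) ((R + 2 * D + 1) * t)) := by
      rw [hfund.measure_eq_tsum' (Metric.ball (0 : E) ((R + 2 * D + 1) * t))]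
      refine le_trans (le_of_eq ?_) (ENNReal.sum_le_tsum S)
      rw [← nsmul_eq_mul, ← Finset.sum_const]
      refine Finset.sum_congr rfl fun v hv => ?_
      have hv' : ‖(v : E)‖ ≤ t * R + D := by simpa [hS] using hv
      rw [inter_eq_right.mpr, measure_vadd]
      rintro _ ⟨x, hx, rfl⟩
      have h2 := hPD x hx
      have : (v +ᵥ x) = (v : E) + x := rfl
      simp only [this, mem_ball_zero_iff]
      have h3 := norm_add_le (v : E) x
      nlinarith
    have h4 : μ (Metric.ball (0 : E) ((R + 2 * D + 1) * t)) ≠ ⊤ := measure_ball_lt_top.ne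
    have h5 := ENNReal.toReal_mono h4 h1
    rw [ENNReal.toReal_mul, ENNReal.toReal_natCast, Measure.addHaar_ball_of_pos _ _ (by positivity),
      ENNReal.toReal_mul, ENNReal.toReal_ofReal (by positivity)] at h5
    refine h5.trans (le_of_eq ?_)
    rw [hB, Measure.real, mul_pow]; ring
  have hterm : ∀ v ∈ S, |∫ x in P, φ (v +ᵥ x) ∂μ - μ.real P * φ v| ≤ L * D / t * μ.real P := by
    intro v hv
    have hi : IntegrableOn (fun x : E => φ (v +ᵥ x)) P μ :=
      (hφi.comp_add_left (v : E)).integrableOn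
    have h1 : ∫ x in P, φ (v +ᵥ x) ∂μ - μ.real P * φ v = ∫ x in P, (φ (v +ᵥ x) - φ v) ∂μ := by
      rw [integral_sub hi (integrableOn_const hPfin), setIntegral_const]; rfl
    rw [h1, ← Real.norm_eq_abs]
    refine norm_setIntegral_le_of_norm_le_const hPfin.lt_top fun x hx => ?_
    have := hf.dist_le_mul (t⁻¹ • (v +ᵥ x)) (t⁻¹ • (v : E))
    rw [Real.dist_eq, dist_eq_norm, ← smul_sub] at this
    refine this.trans ?_
    have h6 : (v +ᵥ x) - (v : E) = x := by
      have : (v +ᵥ x) = (v : E) + x := rfl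
      rw [this]; abel
    rw [h6, norm_smul, norm_inv, Real.norm_of_nonneg ht0.le, mul_div_assoc, div_eq_inv_mul]
    gcongr
    exact hPD x hx
  have hfinal : |∑ v ∈ S, φ v * μ.real P - t ^ d * ∫ x, f x ∂μ| ≤
      (L * D) * ((R + 2 * D + 1) ^ d * B) * (t ^ d / t) := by
    rw [← hInt, hsum2, abs_sub_comm, ← Finset.sum_sub_distrib]
    refine (Finset.abs_sum_le_sum_abs _ _).trans ?_
    calc _ ≤ ∑ v ∈ S, L * D / t * μ.real P := by
          refine Finset.sum_le_sum fun v hv => ?_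
          have := hterm v hv
          rwa [mul_comm (μ.real P)] at this
      _ = L * D / t * (S.card * μ.real P) := by rw [Finset.sum_const, nsmul_eq_mul]; ring
      _ ≤ L * D / t * (((R + 2 * D + 1) ^ d * B) * t ^ d) := by gcongr
      _ = _ := by ring
  rw [hsum1]
  rw [← Finset.sum_mul] at hfinal
  have h7 : ∑ v ∈ S, φ v - (∫ x, f x ∂μ) / μ.real P * t ^ d =
      ((∑ v ∈ S, φ v) * μ.real P - t ^ d * ∫ x, f x ∂μ) / μ.real P := by
    field_simp
  rw [h7, abs_div, abs_of_pos hPr, div_mul_eq_mul_div]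
  gcongr

end LatticeSum

namespace NumberFieldTestFunction
open NumberField NumberField.InfinitePlace NumberField.mixedEmbedding Module
open NumberField.mixedEmbedding.fundamentalCone NumberField.Units
  NumberField.Units.dirichletUnitTheorem

noncomputable def smoothTent (t : ℝ) : ℝ := Real.smoothTransition t - Real.smoothTransition (t - 1)

theorem contDiff_smoothTent : ContDiff ℝ 1 smoothTent :=
  (Real.smoothTransition.contDiff (n := 1)).sub
    ((Real.smoothTransition.contDiff (n := 1)).comp (contDiff_id.sub contDiff_const))

theorem smoothTent_ne_zero {t : ℝ} (h : smoothTent t ≠ 0) : 0 < t ∧ t < 2 := by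
  constructor
  · by_contra! h0
    exact h (by simp [smoothTent, Real.smoothTransition.zero_of_nonpos h0,
      Real.smoothTransition.zero_of_nonpos (show t - 1 ≤ 0 by linarith)])
  · by_contra! h0
    exact h (by simp [smoothTent, Real.smoothTransition.one_of_one_le (show 1 ≤ t by linarith),
      Real.smoothTransition.one_of_one_le (show 1 ≤ t - 1 by linarith)])

theorem smoothTent_add_intCast_eq_zero {t : ℝ} {n : ℤ}
    (hn : n ∉ ({-⌊t⌋, 1 - ⌊t⌋} : Finset ℤ)) : smoothTent (t + n) = 0 := by
  by_contra h
  obtain ⟨h1, h2⟩ := smoothTent_ne_zero h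
  apply hn
  have h3 := Int.floor_le t
  have h4 := Int.lt_floor_add_one t
  have h5 : -1 < ⌊t⌋ + n := by
    have : (-1 : ℝ) < ⌊t⌋ + n := by linarith
    exact_mod_cast this
  have h6 : ⌊t⌋ + n < 2 := by
    have : (⌊t⌋ + n : ℝ) < 2 := by linarith
    exact_mod_cast this
  simp only [Finset.mem_insert, Finset.mem_singleton]
  omega

theorem sum_smoothTent (t : ℝ) :
    ∑ n ∈ ({-⌊t⌋, 1 - ⌊t⌋} : Finset ℤ), smoothTent (t + n) = 1 := by
  have h3 := Int.floor_le t
  have h4 := Int.lt_floor_add_one t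
  rw [Finset.sum_pair (by omega)]
  simp only [smoothTent]
  push_cast
  rw [Real.smoothTransition.zero_of_nonpos (show t + -(⌊t⌋ : ℝ) - 1 ≤ 0 by linarith),
    Real.smoothTransition.one_of_one_le (show 1 ≤ t + (1 - (⌊t⌋ : ℝ)) by linarith),
    show t + (1 - (⌊t⌋ : ℝ)) - 1 = t + -(⌊t⌋ : ℝ) by ring]
  ring

theorem hasSum_prod_smoothTent {ι : Type*} [Fintype ι] (y : ι → ℝ) :
    HasSum (fun m : ι → ℤ => ∏ i, smoothTent (y i + m i)) 1 := by
  have h : ∑ m ∈ Fintype.piFinset fun i => ({-⌊y i⌋, 1 - ⌊y i⌋} : Finset ℤ),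
      ∏ i, smoothTent (y i + m i) = 1 := by
    refine (Finset.prod_univ_sum (fun i => ({-⌊y i⌋, 1 - ⌊y i⌋} : Finset ℤ))
      (fun i n => smoothTent (y i + (n : ℤ)))).symm.trans ?_
    exact Finset.prod_eq_one fun i _ => sum_smoothTent (y i)
  rw [← h]
  refine hasSum_sum_of_ne_finset_zero fun m hm => ?_
  simp only [Fintype.mem_piFinset, not_forall] at hm
  obtain ⟨i, hi⟩ := hm
  exact Finset.prod_eq_zero (Finset.mem_univ i) (smoothTent_add_intCast_eq_zero hi)

variable (K : Type*) [Field K] [NumberField K]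

/-- The coordinates of the logarithm of `x` on a basis of the unit lattice. -/
noncomputable def logCoord (x : mixedSpace K) (i : Fin (rank K)) : ℝ :=
  ((basisUnitLattice K).ofZLatticeBasis ℝ _).repr (logMap x) i

/-- A function on the mixed space, whose sum over an orbit of the units is a function of the norm
only. -/
noncomputable def testFun (g : ℝ → ℝ) (x : mixedSpace K) : ℝ :=
  g (mixedEmbedding.norm x) * ∏ i, smoothTent (logCoord K x i)

variable {K}

theorem contDiffAt_normAtPlace (w : InfinitePlace K) {x : mixedSpace K}
    (hx : normAtPlace w x ≠ 0) : ContDiffAt ℝ 1 (fun y : mixedSpace K => normAtPlace w y) x := by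
  by_cases hw : IsReal w
  · simp_rw [normAtPlace_apply_of_isReal hw] at hx ⊢
    refine ContDiffAt.norm ℝ ?_ (norm_ne_zero_iff.mp hx)
    fun_prop
  · have hw' := not_isReal_iff_isComplex.mp hw
    simp_rw [normAtPlace_apply_of_isComplex hw'] at hx ⊢
    refine ContDiffAt.norm ℝ ?_ (norm_ne_zero_iff.mp hx)
    fun_prop

theorem contDiffAt_norm {x : mixedSpace K} (hx : mixedEmbedding.norm x ≠ 0) :
    ContDiffAt ℝ 1 (fun y : mixedSpace K => mixedEmbedding.norm y) x := by
  simp_rw [mixedEmbedding.norm_apply]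
  refine contDiffAt_prod fun w _ => ?_
  exact (contDiffAt_normAtPlace w (mixedEmbedding.norm_ne_zero_iff.mp hx w)).pow _

theorem contDiffAt_logMap {x : mixedSpace K} (hx : mixedEmbedding.norm x ≠ 0) :
    ContDiffAt ℝ 1 (fun y : mixedSpace K => logMap y) x := by
  rw [contDiffAt_pi]
  intro w
  simp_rw [logMap_apply]
  refine contDiffAt_const.mul (ContDiffAt.sub ?_ (ContDiffAt.mul ?_ contDiffAt_const))
  · exact (contDiffAt_normAtPlace _ (mixedEmbedding.norm_ne_zero_iff.mp hx _)).log
      (mixedEmbedding.norm_ne_zero_iff.mp hx _)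
  · exact (contDiffAt_norm hx).log hx

theorem contDiff_testFun {g : ℝ → ℝ} (hg : ContDiff ℝ 1 g) (hg0 : ∀ y, y < 1 / 2 → g y = 0) :
    ContDiff ℝ 1 (testFun K g) := by
  rw [contDiff_iff_contDiffAt]
  intro x
  by_cases hx : mixedEmbedding.norm x = 0
  · have : ∀ᶠ y in nhds x, testFun K g y = 0 := by
      have h1 : ∀ᶠ y in nhds x, mixedEmbedding.norm y < 1 / 2 :=
        (mixedEmbedding.continuous_norm K).continuousAt.eventually_lt continuousAt_const
          (by rw [hx]; norm_num)
      filter_upwards [h1] with y hy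
      rw [testFun, hg0 _ hy, zero_mul]
    exact (contDiffAt_const (c := (0 : ℝ))).congr_of_eventuallyEq this
  · refine ContDiffAt.mul (hg.contDiffAt.comp x (contDiffAt_norm hx)) ?_
    refine contDiffAt_prod fun i _ => ?_
    refine contDiff_smoothTent.contDiffAt.comp x ?_
    let l : logSpace K →L[ℝ] ℝ :=
      LinearMap.toContinuousLinearMap (((basisUnitLattice K).ofZLatticeBasis ℝ _).coord i)
    exact l.contDiff.contDiffAt.comp x (contDiffAt_logMap hx)

theorem log_normAtPlace_le {x : mixedSpace K} (hpl : ∀ w, normAtPlace w x ≠ 0) {A : ℝ}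
    (hA0 : 0 ≤ A) (hlog : |Real.log (mixedEmbedding.norm x)| ≤ Real.log 2)
    (hw : ∀ w : InfinitePlace K, w ≠ w₀ → |Real.log (normAtPlace w x)| ≤ A)
    (w : InfinitePlace K) : Real.log (normAtPlace w x) ≤ Real.log 2 + finrank ℚ K * A := by
  have hl2 : 0 ≤ Real.log 2 := Real.log_nonneg (by norm_num)
  have hd1 : (1 : ℝ) ≤ finrank ℚ K := by exact_mod_cast finrank_pos (R := ℚ) (M := K)
  by_cases hw0 : w = w₀
  · have h7 : ∑ w : InfinitePlace K, mult w * Real.log (normAtPlace w x) =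
        Real.log (mixedEmbedding.norm x) := by
      rw [mixedEmbedding.norm_apply, Real.log_prod fun w _ => pow_ne_zero _ (hpl w)]
      simp
    rw [← Finset.add_sum_erase _ _ (Finset.mem_univ w)] at h7
    have h8 : -∑ v ∈ Finset.univ.erase w, mult v * Real.log (normAtPlace v x) ≤
        ∑ v ∈ Finset.univ.erase w, mult v * A := by
      rw [← Finset.sum_neg_distrib]
      refine Finset.sum_le_sum fun v hv => ?_
      rw [← mul_neg]
      gcongr
      have := hw v (by rw [← hw0]; exact Finset.ne_of_mem_erase hv)
      exact (neg_le_abs _).trans this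
    have h9 : ∑ v ∈ Finset.univ.erase w, (mult v : ℝ) * A ≤ finrank ℚ K * A := by
      rw [← Finset.sum_mul]
      gcongr
      rw [← sum_mult_eq (K := K)]
      push_cast
      exact Finset.sum_le_sum_of_subset_of_nonneg (Finset.erase_subset _ _)
        fun _ _ _ => by positivity
    have h10 : mult w * Real.log (normAtPlace w x) ≤ Real.log 2 + finrank ℚ K * A := by
      have := (abs_le.mp hlog).2
      linarith
    by_cases hs : 0 ≤ Real.log (normAtPlace w x)
    · have h4 : (1 : ℝ) ≤ mult w := by exact_mod_cast mult_pos (w := w)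
      exact (le_mul_of_one_le_left hs h4).trans h10
    · have : 0 ≤ finrank ℚ K * A := by positivity
      linarith
  · have h1 := (abs_le.mp (hw w hw0)).2
    have h2 : A ≤ finrank ℚ K * A := le_mul_of_one_le_left hA0 hd1
    linarith

theorem exists_testFun_eq_zero {g : ℝ → ℝ} (hg0 : ∀ y, y < 1 / 2 → g y = 0)
    (hg2 : ∀ y, 2 < y → g y = 0) :
    ∃ R, 0 ≤ R ∧ ∀ x : mixedSpace K, R < ‖x‖ → testFun K g x = 0 := by
  set b := (basisUnitLattice K).ofZLatticeBasis ℝ _ with hb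
  set D := ∑ i, 2 * ‖b i‖ with hD
  have hD0 : 0 ≤ D := Finset.sum_nonneg fun _ _ => by positivity
  set A := D + Real.log 2 with hA
  have hl2 : 0 ≤ Real.log 2 := Real.log_nonneg (by norm_num)
  refine ⟨Real.exp (Real.log 2 + finrank ℚ K * A), (Real.exp_pos _).le, fun x hx => ?_⟩
  by_contra h
  have h1 : g (mixedEmbedding.norm x) ≠ 0 := left_ne_zero_of_mul h
  have h2 := right_ne_zero_of_mul h
  rw [Finset.prod_ne_zero_iff] at h2
  have hn1 : 1 / 2 ≤ mixedEmbedding.norm x := not_lt.mp fun h => h1 (hg0 _ h)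
  have hn2 : mixedEmbedding.norm x ≤ 2 := not_lt.mp fun h => h1 (hg2 _ h)
  have hn0 : mixedEmbedding.norm x ≠ 0 := by linarith
  have hlog : |Real.log (mixedEmbedding.norm x)| ≤ Real.log 2 := by
    rw [abs_le]
    constructor
    · rw [← Real.log_inv]; exact Real.log_le_log (by norm_num) (by linarith)
    · exact Real.log_le_log (by linarith) hn2
  have hpl := mixedEmbedding.norm_ne_zero_iff.mp hn0
  have hd1 : (1 : ℝ) ≤ finrank ℚ K := by exact_mod_cast finrank_pos (R := ℚ) (M := K)
  have hlm : ‖logMap x‖ ≤ D := by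
    rw [← b.sum_repr (logMap x)]
    refine (norm_sum_le _ _).trans (Finset.sum_le_sum fun i _ => ?_)
    rw [_root_.norm_smul]
    gcongr
    have := smoothTent_ne_zero (h2 i (Finset.mem_univ i))
    rw [Real.norm_eq_abs, abs_le]
    change 0 < b.repr (logMap x) i ∧ b.repr (logMap x) i < 2 at this
    constructor <;> linarith
  have hw : ∀ w : InfinitePlace K, w ≠ w₀ → |Real.log (normAtPlace w x)| ≤ A := by
    intro w hw
    have h3 := (norm_le_pi_norm (logMap x) ⟨w, hw⟩).trans hlm
    rw [logMap_apply, norm_mul, Real.norm_natCast] at h3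
    have h4 : (1 : ℝ) ≤ mult w := by exact_mod_cast mult_pos (w := w)
    have h5 : |Real.log (normAtPlace w x) -
      Real.log (mixedEmbedding.norm x) * (finrank ℚ K : ℝ)⁻¹| ≤ D :=
      (le_mul_of_one_le_left (norm_nonneg _) h4).trans h3
    have h6 : |Real.log (mixedEmbedding.norm x) * (finrank ℚ K : ℝ)⁻¹| ≤ Real.log 2 := by
      rw [abs_mul, abs_of_nonneg (by positivity : (0 : ℝ) ≤ (finrank ℚ K : ℝ)⁻¹)]
      exact (mul_le_of_le_one_right (abs_nonneg _) (inv_le_one_of_one_le₀ hd1)).trans hlog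
    rw [hA]
    rw [abs_le] at h5 h6 ⊢
    constructor <;> linarith
  have hall := log_normAtPlace_le hpl (by positivity) hlog hw
  refine hx.not_ge ?_
  rw [norm_eq_sup'_normAtPlace]
  refine Finset.sup'_le _ _ fun w _ => ?_
  exact (Real.log_le_iff_le_exp ((normAtPlace_nonneg w x).lt_of_ne' (hpl w))).mp (hall w)

end NumberFieldTestFunction

open scoped Classical nonZeroDivisors
namespace NumberFieldTestFunction
open NumberField NumberField.InfinitePlace NumberField.mixedEmbedding Module
open NumberField.mixedEmbedding.fundamentalCone NumberField.Units
  NumberField.Units.dirichletUnitTheorem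

variable {K : Type*} [Field K] [NumberField K]

theorem logCoord_unit_smul (ζ : torsion K) (m : Fin (rank K) → ℤ) {x : mixedSpace K}
    (hx : mixedEmbedding.norm x ≠ 0) (i : Fin (rank K)) :
    logCoord K (((ζ : (𝓞 K)ˣ) * ∏ i, fundSystem K i ^ m i) • x) i = logCoord K x i + m i := by
  set b := (basisUnitLattice K).ofZLatticeBasis ℝ _ with hb
  have h : logEmbedding K (Additive.ofMul ((ζ : (𝓞 K)ˣ) * ∏ i, fundSystem K i ^ m i)) =
      ∑ i, (m i : ℝ) • b i := by
    rw [ofMul_mul, map_add, ofMul_prod, map_sum]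
    have h1 : logEmbedding K (Additive.ofMul (ζ : (𝓞 K)ˣ)) = 0 :=
      logEmbedding_eq_zero_iff.mpr ζ.2
    rw [h1, zero_add]
    refine Finset.sum_congr rfl fun j _ => ?_
    rw [ofMul_zpow, map_zsmul, logEmbedding_fundSystem, hb, Basis.ofZLatticeBasis_apply,
      Int.cast_smul_eq_zsmul]
  rw [logCoord, logMap_unit_smul _ hx, h, map_add, Finsupp.add_apply, Basis.repr_sum_self, logCoord,
    add_comm]

theorem hasSum_prod_const_left {T β : Type*} [Finite T] {f : β → ℝ} {a : ℝ} (hf : HasSum f a) :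
    HasSum (fun p : T × β => f p.2) (Nat.card T * a) := by
  have := Fintype.ofFinite T
  have h1 : HasSum (fun _ : T => (1 : ℝ)) (Nat.card T) := by
    have := hasSum_fintype (fun _ : T => (1 : ℝ))
    simpa [Nat.card_eq_fintype_card] using this
  simpa using h1.mul hf (summable_mul_of_summable_norm h1.summable.norm hf.summable.norm)

variable (K) in
theorem exists_units_equiv : ∃ e : torsion K × (Fin (rank K) → ℤ) ≃ (𝓞 K)ˣ,
    ∀ p, e p = (p.1 : (𝓞 K)ˣ) * ∏ i, fundSystem K i ^ p.2 i := by
  refine ⟨Equiv.ofBijective (fun p => (p.1 : (𝓞 K)ˣ) * ∏ i, fundSystem K i ^ p.2 i) ?_,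
    fun p => rfl⟩
  rw [Function.bijective_iff_existsUnique]
  intro u
  obtain ⟨p, hp, hu⟩ := exist_unique_eq_mul_prod K u
  exact ⟨p, hp.symm, fun q hq => hu q hq.symm⟩

theorem hasSum_testFun_units (g : ℝ → ℝ) {x : mixedSpace K} (hx : mixedEmbedding.norm x ≠ 0) :
    HasSum (fun u : (𝓞 K)ˣ => testFun K g (u • x))
      (torsionOrder K * g (mixedEmbedding.norm x)) := by
  obtain ⟨e, he⟩ := exists_units_equiv K
  rw [← e.hasSum_iff]
  have h2 := (hasSum_prod_smoothTent (logCoord K x)).mul_left (g (mixedEmbedding.norm x))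
  rw [mul_one] at h2
  have h3 := hasSum_prod_const_left (T := torsion K) h2
  convert! h3 using 2 with p
  rw [Function.comp_apply, he, testFun, norm_unit_smul]
  congr 1
  exact Finset.prod_congr rfl fun i _ => by rw [logCoord_unit_smul p.1 p.2 hx]

theorem exists_generator {C : ClassGroup (𝓞 K)} {J : (Ideal (𝓞 K))⁰}
    (hJ : ClassGroup.mk0 J = C⁻¹) (I : {I : (Ideal (𝓞 K))⁰ // ClassGroup.mk0 I = C}) :
    ∃ γ : 𝓞 K, γ ≠ 0 ∧ (J : Ideal (𝓞 K)) * (I.1 : Ideal (𝓞 K)) = Ideal.span {γ} := by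
  have h : ClassGroup.mk0 (J * I.1) = 1 := by rw [map_mul, hJ, I.2]; simp
  have h2 := (ClassGroup.mk0_eq_one_iff (J * I.1).2).mp h
  obtain ⟨γ, hγ⟩ := h2.principal
  refine ⟨γ, ?_, hγ⟩
  rintro rfl
  refine nonZeroDivisors.coe_ne_zero (J * I.1) ?_
  rw [hγ]; simp

theorem norm_mixedEmbedding_eq (a : 𝓞 K) :
    mixedEmbedding.norm (mixedEmbedding K (a : K)) = Ideal.absNorm (Ideal.span {a}) := by
  rw [mixedEmbedding.norm_eq_norm, Ideal.absNorm_span_singleton, ← Algebra.coe_norm_int]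
  simp [Nat.cast_natAbs]

theorem hasSum_testFun_idealLattice {C : ClassGroup (𝓞 K)} {J : (Ideal (𝓞 K))⁰}
    (hJ : ClassGroup.mk0 J = C⁻¹) {g : ℝ → ℝ} (hg0 : ∀ y, y < 1 / 2 → g y = 0)
    (hg2 : ∀ y, 2 < y → g y = 0) {t : ℝ} (ht : 0 < t) {ι : Type*} [Fintype ι]
    (b : Basis ι ℝ (mixedSpace K))
    (hb : ∀ x : mixedSpace K, x ∈ Submodule.span ℤ (Set.range b) ↔
      ∃ a ∈ (J : Ideal (𝓞 K)), mixedEmbedding K (a : K) = x) :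
    HasSum (fun I : {I : (Ideal (𝓞 K))⁰ // ClassGroup.mk0 I = C} => torsionOrder K *
        g (Ideal.absNorm (J : Ideal (𝓞 K)) * Ideal.absNorm (I.1 : Ideal (𝓞 K)) /
          t ^ finrank ℚ K))
      (∑' v : Submodule.span ℤ (Set.range b), testFun K g (t⁻¹ • (v : mixedSpace K))) := by
  obtain ⟨R, hR0, hR⟩ := exists_testFun_eq_zero (K := K) hg0 hg2
  have hsupp : Set.Finite {v : Submodule.span ℤ (Set.range b) | ‖(v : mixedSpace K)‖ ≤ t * R} := by
    have := ZSpan.setFinite_inter b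
      (Metric.isBounded_closedBall (x := (0 : mixedSpace K)) (r := t * R))
    refine Set.Finite.of_finite_image (f := Subtype.val) (this.subset ?_) Subtype.val_injective.injOn
    rintro _ ⟨v, hv, rfl⟩
    exact ⟨by simpa using hv, v.2⟩
  have hsum : HasSum (fun v : Submodule.span ℤ (Set.range b) =>
      testFun K g (t⁻¹ • (v : mixedSpace K)))
      (∑' v : Submodule.span ℤ (Set.range b), testFun K g (t⁻¹ • (v : mixedSpace K))) := by
    refine (summable_of_ne_finset_zero (s := hsupp.toFinset) fun v hv => hR _ ?_).hasSum
    rw [_root_.norm_smul, norm_inv, Real.norm_of_nonneg ht.le, lt_inv_mul_iff₀ ht]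
    simpa using hv
  choose γ hγ0 hγ using exists_generator hJ
  have hmem : ∀ I (u : (𝓞 K)ˣ), (u : 𝓞 K) * γ I ∈ (J : Ideal (𝓞 K)) := by
    intro I u
    refine Ideal.mul_mem_left _ _ (Ideal.mul_le_left (I := (J : Ideal (𝓞 K))) (J := I.1) ?_)
    rw [hγ]
    exact Ideal.mem_span_singleton_self _
  let Ψ : {I : (Ideal (𝓞 K))⁰ // ClassGroup.mk0 I = C} × (𝓞 K)ˣ →
      Submodule.span ℤ (Set.range b) := fun p =>
    ⟨mixedEmbedding K (((p.2 : 𝓞 K) * γ p.1 : 𝓞 K) : K), (hb _).mpr ⟨_, hmem p.1 p.2, rfl⟩⟩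
  have hinj : Function.Injective Ψ := by
    rintro ⟨I, u⟩ ⟨I', u'⟩ h
    have h1 : (u : 𝓞 K) * γ I = u' * γ I' := by
      have := mixedEmbedding_injective K (Subtype.ext_iff.mp h)
      exact RingOfIntegers.coe_injective this
    have h2 : Ideal.span {γ I} = Ideal.span {γ I'} := by
      rw [Ideal.span_singleton_eq_span_singleton]
      exact ((associated_unit_mul_left _ _ u.isUnit).symm.trans
        (Associated.of_eq h1)).trans (associated_unit_mul_left _ _ u'.isUnit)
    have h3 : I = I' := by
      rw [← hγ, ← hγ] at h2
      exact Subtype.ext (Subtype.ext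
        (mul_left_cancel₀ (nonZeroDivisors.coe_ne_zero J) h2))
    subst h3
    have h4 := mul_right_cancel₀ (hγ0 I) h1
    rw [Units.ext h4]
  have hrange : ∀ v ∉ Set.range Ψ, testFun K g (t⁻¹ • (v : mixedSpace K)) = 0 := by
    intro v hv
    obtain ⟨a, haJ, hav⟩ := (hb v).mp v.2
    by_cases ha : a = 0
    · rw [← hav, ha, testFun]
      simp [hg0 0 (by norm_num)]
    · exfalso
      apply hv
      obtain ⟨I, hI⟩ := Ideal.dvd_span_singleton.mpr haJ
      have hI0 : I ≠ 0 := by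
        rintro rfl
        rw [mul_zero] at hI
        exact ha (by simpa using hI)
      have hI1 : I ∈ (Ideal (𝓞 K))⁰ := mem_nonZeroDivisors_of_ne_zero hI0
      have hcl : ClassGroup.mk0 (J * ⟨I, hI1⟩) = 1 := by
        rw [ClassGroup.mk0_eq_one_iff]
        exact ⟨a, hI.symm⟩
      have hC : ClassGroup.mk0 (⟨I, hI1⟩ : (Ideal (𝓞 K))⁰) = C := by
        rw [map_mul, hJ, inv_mul_eq_one] at hcl
        exact hcl.symm
      have h5 : Ideal.span {γ ⟨⟨I, hI1⟩, hC⟩} = Ideal.span {a} := by rw [← hγ, hI]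
      obtain ⟨u, hu⟩ := Ideal.span_singleton_eq_span_singleton.mp h5
      refine ⟨(⟨⟨I, hI1⟩, hC⟩, u), Subtype.ext ?_⟩
      simp only [Ψ]
      rw [← hav, ← hu, mul_comm]
  have h6 := (hinj.hasSum_iff hrange).mpr hsum
  refine h6.prod_fiberwise fun I => ?_
  have hx0 : mixedEmbedding.norm (t⁻¹ • mixedEmbedding K (γ I : K)) =
      Ideal.absNorm (J : Ideal (𝓞 K)) * Ideal.absNorm (I.1 : Ideal (𝓞 K)) /
          t ^ finrank ℚ K := by
    rw [mixedEmbedding.norm_smul, norm_mixedEmbedding_eq, ← hγ, map_mul, abs_of_pos (by positivity)]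
    push_cast
    rw [inv_pow, div_eq_inv_mul]
  have hx1 : mixedEmbedding.norm (t⁻¹ • mixedEmbedding K (γ I : K)) ≠ 0 := by
    rw [hx0]
    have h7 : (Ideal.absNorm (J : Ideal (𝓞 K)) : ℝ) ≠ 0 :=
      Nat.cast_ne_zero.mpr (Ideal.absNorm_ne_zero_of_nonZeroDivisors J)
    have h8 : (Ideal.absNorm (I.1 : Ideal (𝓞 K)) : ℝ) ≠ 0 :=
      Nat.cast_ne_zero.mpr (Ideal.absNorm_ne_zero_of_nonZeroDivisors I.1)
    positivity
  have h9 := hasSum_testFun_units g hx1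
  rw [hx0] at h9
  convert! h9 using 2 with u
  simp only [Function.comp_apply, Ψ, unitSMul_smul]
  rw [mul_smul_comm, ← map_mul]
  simp

end NumberFieldTestFunction

open scoped Classical nonZeroDivisors
namespace NumberFieldTestFunction
open NumberField NumberField.InfinitePlace NumberField.mixedEmbedding Module
open NumberField.mixedEmbedding.fundamentalCone NumberField.Units
  NumberField.Units.dirichletUnitTheorem

universe u
variable {K : Type u} [Field K] [NumberField K]

theorem exists_idealLattice_basis (J : (Ideal (𝓞 K))⁰) :
    ∃ (ι : Type u) (_ : Fintype ι) (b : Basis ι ℝ (mixedSpace K)),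
      ∀ x : mixedSpace K, x ∈ Submodule.span ℤ (Set.range b) ↔
        ∃ a ∈ (J : Ideal (𝓞 K)), mixedEmbedding K (a : K) = x := by
  refine ⟨_, inferInstance, fractionalIdealLatticeBasis K (FractionalIdeal.mk0 K J), fun x => ?_⟩
  rw [mem_span_fractionalIdealLatticeBasis]
  constructor
  · rintro ⟨y, hy, rfl⟩
    rw [FractionalIdeal.coe_mk0] at hy
    obtain ⟨a, ha, rfl⟩ := (FractionalIdeal.mem_coeIdeal _).mp hy
    exact ⟨a, ha, rfl⟩
  · rintro ⟨a, ha, rfl⟩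
    refine ⟨a, ?_, rfl⟩
    rw [FractionalIdeal.coe_mk0]
    exact (FractionalIdeal.mem_coeIdeal _).mpr ⟨a, ha, rfl⟩

theorem abs_tsum_class_sub_le {g : ℝ → ℝ} (hg : ContDiff ℝ 1 g)
    (hg0 : ∀ y, y < 1 / 2 → g y = 0) (hg2 : ∀ y, 2 < y → g y = 0) (C : ClassGroup (𝓞 K)) :
    ∃ κ M : ℝ, ∀ x : ℝ, 1 ≤ x →
      |∑' I : {I : (Ideal (𝓞 K))⁰ // ClassGroup.mk0 I = C},
        g (Ideal.absNorm (I.1 : Ideal (𝓞 K)) / x) - κ * x| ≤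
        M * x ^ (1 - 1 / (finrank ℚ K : ℝ)) := by
  obtain ⟨J, hJ⟩ := ClassGroup.mk0_surjective C⁻¹
  obtain ⟨ι, _, b, hb⟩ := exists_idealLattice_basis J
  obtain ⟨R, hR0, hR⟩ := exists_testFun_eq_zero (K := K) hg0 hg2
  have hcs : HasCompactSupport (testFun K g) :=
    HasCompactSupport.intro (isCompact_closedBall (0 : mixedSpace K) R) fun x hx => by
      apply hR; simpa using hx
  obtain ⟨L, hL⟩ := ContDiff.lipschitzWith_of_hasCompactSupport hcs
    (contDiff_testFun (K := K) hg hg0) one_ne_zero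
  obtain ⟨M, hM⟩ := LatticeSum.abs_sum_sub_integral_le MeasureTheory.volume b hL hR0 hR
  rw [mixedEmbedding.finrank] at hM
  set A := (∫ x, testFun K g x) / MeasureTheory.volume.real (ZSpan.fundamentalDomain b)
  clear_value A
  set N : ℝ := ((Ideal.absNorm (J : Ideal (𝓞 K)) : ℕ) : ℝ) with hN
  have hN1 : 1 ≤ N := by
    have := Nat.one_le_iff_ne_zero.mpr (Ideal.absNorm_ne_zero_of_nonZeroDivisors J)
    rw [hN]
    exact_mod_cast this
  have hw : (0 : ℝ) < torsionOrder K := by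
    exact_mod_cast Nat.pos_of_ne_zero (torsionOrder_ne_zero K)
  have hd : 0 < finrank ℚ K := finrank_pos
  refine ⟨A * N / torsionOrder K, M * N ^ (1 - 1 / (finrank ℚ K : ℝ)) / torsionOrder K,
    fun x hx => ?_⟩
  have hNx : 1 ≤ N * x := one_le_mul_of_one_le_of_one_le hN1 hx
  have hNx0 : 0 < N * x := by linarith
  set t : ℝ := (N * x) ^ (1 / (finrank ℚ K : ℝ)) with ht
  have ht1 : 1 ≤ t := Real.one_le_rpow hNx (by positivity)
  have htd : t ^ finrank ℚ K = N * x := by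
    rw [ht, one_div, Real.rpow_inv_natCast_pow hNx0.le hd.ne']
  have h1 := (hasSum_testFun_idealLattice hJ hg0 hg2 (by linarith : 0 < t) b hb).tsum_eq
  simp only [← hN] at h1
  rw [htd, tsum_mul_left] at h1
  have h2 := hM t ht1
  have htt : t ^ finrank ℚ K / t = N ^ (1 - 1 / (finrank ℚ K : ℝ)) *
      x ^ (1 - 1 / (finrank ℚ K : ℝ)) := by
    rw [htd, ht, ← Real.mul_rpow (by linarith) (by linarith), Real.rpow_sub hNx0, Real.rpow_one]
  rw [htt, htd, ← h1] at h2
  have h3 : ∀ I : {I : (Ideal (𝓞 K))⁰ // ClassGroup.mk0 I = C},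
      N * Ideal.absNorm (I.1 : Ideal (𝓞 K)) / (N * x) = Ideal.absNorm (I.1 : Ideal (𝓞 K)) / x :=
    fun I => mul_div_mul_left _ _ (by linarith)
  simp only [h3] at h2
  set S := ∑' I : {I : (Ideal (𝓞 K))⁰ // ClassGroup.mk0 I = C},
        g (Ideal.absNorm (I.1 : Ideal (𝓞 K)) / x)
  have h4 : S - A * N / torsionOrder K * x = (torsionOrder K * S - A * (N * x)) / torsionOrder K := by
    field_simp
  rw [h4, abs_div, abs_of_pos hw, div_mul_eq_mul_div]
  refine div_le_div_of_nonneg_right ?_ hw.le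
  linarith

theorem summable_absNorm {g : ℝ → ℝ} (hg2 : ∀ y, 2 < y → g y = 0) {x : ℝ} (hx : 0 < x) :
    Summable fun I : (Ideal (𝓞 K))⁰ => g (Ideal.absNorm (I : Ideal (𝓞 K)) / x) := by
  have hfin := Ideal.finite_setOfPred_absNorm_le₀ (S := 𝓞 K) ⌊2 * x⌋₊
  refine summable_of_ne_finset_zero (s := hfin.toFinset) fun I hI => hg2 _ ?_
  rw [lt_div_iff₀ hx]
  have : ¬ Ideal.absNorm (I : Ideal (𝓞 K)) ≤ ⌊2 * x⌋₊ := by simpa using hI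
  exact (Nat.floor_lt (by positivity)).mp (not_le.mp this)

theorem tsum_card_absNorm {g : ℝ → ℝ} (hg0 : ∀ y, y < 1 / 2 → g y = 0)
    (hg2 : ∀ y, 2 < y → g y = 0) {x : ℝ} (hx : 0 < x) :
    ∑' n : ℕ, (Nat.card {I : Ideal (𝓞 K) // Ideal.absNorm I = n} : ℝ) * g (n / x) =
      ∑ C : ClassGroup (𝓞 K), ∑' I : {I : (Ideal (𝓞 K))⁰ // ClassGroup.mk0 I = C},
        g (Ideal.absNorm (I.1 : Ideal (𝓞 K)) / x) := by
  have hs := (summable_absNorm (K := K) hg2 hx).hasSum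
  have h1 := hs.tsum_fiberwise fun I => Ideal.absNorm (I : Ideal (𝓞 K))
  have h2 := hs.tsum_fiberwise fun I => ClassGroup.mk0 I
  rw [← tsum_fintype (L := SummationFilter.unconditional _)]
  refine Eq.trans ?_ (h1.tsum_eq.trans h2.tsum_eq.symm)
  refine tsum_congr fun n => ?_
  have h3 : ∀ I : ((fun I : (Ideal (𝓞 K))⁰ => Ideal.absNorm (I : Ideal (𝓞 K))) ⁻¹' {n}),
      g (Ideal.absNorm (I.1 : Ideal (𝓞 K)) / x) = g (n / x) := fun I => by
    have := I.2
    simp only [Set.mem_preimage, Set.mem_singleton_iff] at this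
    rw [this]
  rw [tsum_congr h3]
  by_cases hn : n = 0
  · simp [hn, hg0 0 (by norm_num)]
  · rw [tsum_const, nsmul_eq_mul]
    congr 2
    have h4 : ∀ I : Ideal (𝓞 K), Ideal.absNorm I = n → I ∈ (Ideal (𝓞 K))⁰ := by
      intro I hI
      refine mem_nonZeroDivisors_of_ne_zero fun h => hn ?_
      rw [← hI, h, Ideal.zero_eq_bot, Ideal.absNorm_bot]
    exact Nat.card_congr ⟨fun I => ⟨⟨I.1, h4 I.1 I.2⟩, I.2⟩, fun I => ⟨I.1.1, I.2⟩,
      fun _ => rfl, fun _ => rfl⟩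

variable (K) in
/-- A smoothed count of the ideals of norm at most `x`, with a power saving error term. -/
theorem abs_tsum_card_absNorm_sub_le {g : ℝ → ℝ} (hg : ContDiff ℝ 1 g)
    (hg0 : ∀ y, y < 1 / 2 → g y = 0) (hg2 : ∀ y, 2 < y → g y = 0) :
    ∃ κ M : ℝ, ∀ x : ℝ, 1 ≤ x →
      |∑' n : ℕ, (Nat.card {I : Ideal (𝓞 K) // Ideal.absNorm I = n} : ℝ) * g (n / x) - κ * x| ≤
        M * x ^ (1 - 1 / (finrank ℚ K : ℝ)) := by
  choose κ M h using abs_tsum_class_sub_le (K := K) hg hg0 hg2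
  refine ⟨∑ C, κ C, ∑ C, M C, fun x hx => ?_⟩
  rw [tsum_card_absNorm hg0 hg2 (by linarith), Finset.sum_mul, Finset.sum_mul,
    ← Finset.sum_sub_distrib]
  exact (Finset.abs_sum_le_sum_abs _ _).trans (Finset.sum_le_sum fun C _ => h C x hx)

end NumberFieldTestFunction

namespace MellinContinuation
open MeasureTheory Filter Set Topology Asymptotics

variable {g : ℝ → ℝ}

theorem mellinConvergent_of_support (hg : Continuous g) (hg0 : ∀ y, y < 1 / 2 → g y = 0)
    (hg2 : ∀ y, 2 < y → g y = 0) (s : ℂ) : MellinConvergent (fun t => (g t : ℂ)) s := by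
  refine mellinConvergent_of_isBigO_rpow (a := s.re + 1) (b := s.re - 1)
    ((by fun_prop : Continuous fun t => (g t : ℂ)).locallyIntegrable.locallyIntegrableOn _) ?_ (by linarith)
    ?_ (by linarith)
  · refine EventuallyEq.trans_isBigO (f₂ := fun _ => (0 : ℂ)) ?_ (isBigO_zero _ _)
    filter_upwards [eventually_gt_atTop 2] with y hy using by simp [hg2 y hy]
  · refine EventuallyEq.trans_isBigO (f₂ := fun _ => (0 : ℂ)) ?_ (isBigO_zero _ _)
    filter_upwards [Ioo_mem_nhdsGT (by norm_num : (0 : ℝ) < 1 / 2)] with y hy using by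
      simp [hg0 y hy.2]

theorem differentiable_mellin_of_support (hg : Continuous g) (hg0 : ∀ y, y < 1 / 2 → g y = 0)
    (hg2 : ∀ y, 2 < y → g y = 0) : Differentiable ℂ (mellin fun t => (g t : ℂ)) := by
  intro s
  refine mellin_differentiableAt_of_isBigO_rpow (a := s.re + 1) (b := s.re - 1)
    ((by fun_prop : Continuous fun t => (g t : ℂ)).locallyIntegrable.locallyIntegrableOn _) ?_ (by linarith)
    ?_ (by linarith)
  · refine EventuallyEq.trans_isBigO (f₂ := fun _ => (0 : ℂ)) ?_ (isBigO_zero _ _)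
    filter_upwards [eventually_gt_atTop 2] with y hy using by simp [hg2 y hy]
  · refine EventuallyEq.trans_isBigO (f₂ := fun _ => (0 : ℂ)) ?_ (isBigO_zero _ _)
    filter_upwards [Ioo_mem_nhdsGT (by norm_num : (0 : ℝ) < 1 / 2)] with y hy using by
      simp [hg0 y hy.2]

theorem integral_norm_comp_mul (s : ℂ) {c : ℝ} (hc : 0 < c) :
    ∫ t in Ioi (0 : ℝ), ‖(t : ℂ) ^ (s - 1) • (g (c * t) : ℂ)‖ =
      c ^ (-s.re) * ∫ t in Ioi (0 : ℝ), ‖(t : ℂ) ^ (s - 1) • (g t : ℂ)‖ := by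
  have h := integral_comp_mul_left_Ioi (fun t => ‖(t : ℂ) ^ (s - 1) • (g t : ℂ)‖) 0 hc
  rw [mul_zero] at h
  have h2 : ∫ t in Ioi (0 : ℝ), ‖((c * t : ℝ) : ℂ) ^ (s - 1) • (g (c * t) : ℂ)‖ =
      c ^ (s.re - 1) * ∫ t in Ioi (0 : ℝ), ‖(t : ℂ) ^ (s - 1) • (g (c * t) : ℂ)‖ := by
    rw [← integral_const_mul]
    refine setIntegral_congr_fun measurableSet_Ioi fun t ht => ?_
    have ht : 0 < t := ht
    simp only [_root_.norm_smul]
    rw [Complex.norm_cpow_eq_rpow_re_of_pos (mul_pos hc ht), Complex.norm_cpow_eq_rpow_re_of_pos ht,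
      Real.mul_rpow hc.le ht.le]
    simp only [Complex.sub_re, Complex.one_re]
    ring
  rw [h2] at h
  have hp : 0 < c ^ (s.re - 1) := Real.rpow_pos_of_pos hc _
  have e : c ^ (-s.re) = c⁻¹ / c ^ (s.re - 1) := by
    rw [← Real.rpow_neg_one, ← Real.rpow_sub hc]; congr 1; ring
  rw [e, div_mul_eq_mul_div, eq_div_iff hp.ne', mul_comm, h, smul_eq_mul]

variable {a : ℕ → ℝ}

theorem mellin_tsum_eq (hg : Continuous g)
    (hg0 : ∀ y, y < 1 / 2 → g y = 0) (hg2 : ∀ y, 2 < y → g y = 0) {s : ℂ}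
    (hs : LSeriesSummable (fun n => (a n : ℂ)) s) :
    mellin (fun t => ((∑' n : ℕ, a n * g (n * t) : ℝ) : ℂ)) s =
      LSeries (fun n => (a n : ℂ)) s * mellin (fun t => (g t : ℂ)) s := by
  have hgz : g 0 = 0 := hg0 0 (by norm_num)
  set F : ℕ → ℝ → ℂ := fun n t => (t : ℂ) ^ (s - 1) • ((a n * g (n * t) : ℝ) : ℂ) with hF
  have hF' : ∀ n t, F n t = (a n : ℂ) * ((t : ℂ) ^ (s - 1) • (g (n * t) : ℂ)) := fun n t => by
    simp only [hF, smul_eq_mul, Complex.ofReal_mul]; ring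
  have hm := mellinConvergent_of_support hg hg0 hg2 s
  have hInt : ∀ n, Integrable (F n) (volume.restrict (Ioi 0)) := by
    intro n
    rcases Nat.eq_zero_or_pos n with rfl | hn
    · have : F 0 = fun _ => 0 := by
        funext t; simp [hF, hgz]
      rw [this]; exact integrable_zero _ _ _
    · have hn' : (0 : ℝ) < n := Nat.cast_pos.2 hn
      have := ((MellinConvergent.comp_mul_left hn').2 hm)
      have h2 : Integrable (fun t : ℝ => (t : ℂ) ^ (s - 1) • (g (n * t) : ℂ))
        (volume.restrict (Ioi 0)) := this
      have h3 := h2.const_mul (a n : ℂ)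
      exact h3.congr (Eventually.of_forall fun t => (hF' n t).symm)
  have hnorm : ∀ n, ∫ t in Ioi (0 : ℝ), ‖F n t‖ =
      ‖LSeries.term (fun n => (a n : ℂ)) s n‖ *
        ∫ t in Ioi (0 : ℝ), ‖(t : ℂ) ^ (s - 1) • (g t : ℂ)‖ := by
    intro n
    rcases Nat.eq_zero_or_pos n with rfl | hn
    · simp [hF, hgz]
    · have hn' : (0 : ℝ) < n := Nat.cast_pos.2 hn
      simp only [hF', norm_mul]
      rw [integral_const_mul]
      have := integral_norm_comp_mul (g := g) s hn'
      rw [this, LSeries.norm_term_eq, if_neg hn.ne', Real.rpow_neg hn'.le]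
      ring
  have key := hasSum_integral_of_summable_integral_norm hInt (by
    simp only [hnorm]
    exact hs.norm.mul_right _)
  have hterm : ∀ n, ∫ t in Ioi (0 : ℝ), F n t =
      LSeries.term (fun n => (a n : ℂ)) s n * mellin (fun t => (g t : ℂ)) s := by
    intro n
    rcases Nat.eq_zero_or_pos n with rfl | hn
    · simp [hF, hgz]
    · have hn' : (0 : ℝ) < n := Nat.cast_pos.2 hn
      have h1 := mellin_comp_mul_left (fun t => (g t : ℂ)) s hn'
      simp only [hF']
      rw [integral_const_mul]
      have h2 : ∫ t in Ioi (0 : ℝ), (t : ℂ) ^ (s - 1) • (g (n * t) : ℂ) =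
        ((n : ℝ) : ℂ) ^ (-s) • mellin (fun t => (g t : ℂ)) s := h1
      rw [h2, LSeries.term_of_ne_zero hn.ne', Complex.cpow_neg, smul_eq_mul, div_eq_mul_inv]
      push_cast
      ring
  simp only [hterm] at key
  have k2 := (hs.hasSum.mul_right (mellin (fun t => (g t : ℂ)) s)).unique key
  rw [LSeries, k2, mellin]
  congr 1
  funext t
  simp only [hF, smul_eq_mul]
  rw [tsum_mul_left, Complex.ofReal_tsum]

theorem tsum_eq_sum_of_lt (hg2 : ∀ y, 2 < y → g y = 0) {N : ℕ} {t : ℝ}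
    (hN : 2 < N * t) (ht : 0 < t) :
    ∑' n : ℕ, a n * g (n * t) = ∑ n ∈ Finset.range N, a n * g (n * t) := by
  refine tsum_eq_sum fun n hn => ?_
  have : (N : ℝ) ≤ n := by exact_mod_cast not_lt.1 (by simpa using hn)
  rw [hg2, mul_zero]
  nlinarith

theorem continuousOn_tsum (hg : Continuous g)
    (hg2 : ∀ y, 2 < y → g y = 0) :
    ContinuousOn (fun t => ∑' n : ℕ, a n * g (n * t)) (Ioi 0) := by
  intro t ht
  have ht : 0 < t := ht
  obtain ⟨N, hN⟩ := exists_nat_gt (4 / t)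
  rw [div_lt_iff₀ ht] at hN
  refine ContinuousAt.continuousWithinAt ?_
  have hc : Continuous fun t => ∑ n ∈ Finset.range N, a n * g (n * t) := by fun_prop
  refine hc.continuousAt.congr ?_
  filter_upwards [lt_mem_nhds (half_lt_self ht)] with u hu
  refine (tsum_eq_sum_of_lt hg2 ?_ (by linarith)).symm
  have : (0 : ℝ) ≤ N := Nat.cast_nonneg _
  nlinarith

end MellinContinuation

namespace MellinContinuation
open MeasureTheory Filter Set Topology Asymptotics

theorem exists_testFunction (s₀ : ℂ) (hs₀ : s₀.re = 1) : ∃ g : ℝ → ℝ, ContDiff ℝ 1 g ∧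
    (∀ y, y < 1 / 2 → g y = 0) ∧ (∀ y, 2 < y → g y = 0) ∧ mellin (fun t => (g t : ℂ)) s₀ ≠ 0 := by
  have hcos : ContinuousAt (fun u : ℝ => Real.cos (s₀.im * Real.log u)) 1 := by
    have := Real.continuousAt_log (one_ne_zero)
    fun_prop
  obtain ⟨δ, hδ, hpos⟩ := Metric.eventually_nhds_iff.1
    (hcos.eventually (lt_mem_nhds (by simp : (0 : ℝ) < Real.cos (s₀.im * Real.log 1))))
  set ε := min δ (1 / 2) with hε
  have hε0 : 0 < ε := lt_min hδ (by norm_num)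
  have hε1 : ε ≤ 1 / 2 := min_le_right _ _
  have hε2 : ε ≤ δ := min_le_left _ _
  clear_value ε
  let φ : ContDiffBump (1 : ℝ) := ⟨ε / 2, ε, by linarith, by linarith⟩
  have hz : ∀ y, ε ≤ |y - 1| → φ y = 0 := fun y hy =>
    φ.zero_of_le_dist (by simpa [Real.dist_eq] using hy)
  have hlow : ∀ y, y < 1 / 2 → φ y = 0 := fun y hy => hz y (by
    rw [abs_of_nonpos (by linarith)]; linarith)
  have hhigh : ∀ y, 2 < y → φ y = 0 := fun y hy => hz y (by
    rw [abs_of_nonneg (by linarith)]; linarith)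
  refine ⟨φ, φ.contDiff, hlow, hhigh, ?_⟩
  intro h0
  have hconv := mellinConvergent_of_support φ.continuous hlow hhigh s₀
  have hre : ∫ t in Ioi (0 : ℝ), Real.cos (s₀.im * Real.log t) * φ t = 0 := by
    have h1 := congrArg Complex.re h0
    rw [mellin] at h1
    have h2 : (∫ t in Ioi (0 : ℝ), (t : ℂ) ^ (s₀ - 1) • (φ t : ℂ)).re =
        ∫ t in Ioi (0 : ℝ), ((t : ℂ) ^ (s₀ - 1) • (φ t : ℂ)).re :=
      (integral_re hconv).symm
    rw [h2] at h1
    refine Eq.trans ?_ h1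
    refine setIntegral_congr_fun measurableSet_Ioi fun t ht => ?_
    have ht : 0 < t := ht
    have : s₀ - 1 = (s₀.im : ℂ) * Complex.I := by
      apply Complex.ext <;> simp [hs₀]
    rw [this, Complex.cpow_def_of_ne_zero (by exact_mod_cast ht.ne'), ← Complex.ofReal_log ht.le,
      ← mul_assoc, ← Complex.ofReal_mul, smul_eq_mul, Complex.re_mul_ofReal,
      Complex.exp_ofReal_mul_I_re, mul_comm s₀.im]
  have hnn : ∀ t, 0 ≤ Real.cos (s₀.im * Real.log t) * φ t := by
    intro t
    rcases lt_or_ge (|t - 1|) ε with h | h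
    · exact mul_nonneg (hpos (by rw [Real.dist_eq]; linarith)).le φ.nonneg
    · rw [hz t h, mul_zero]
  have hInt : IntegrableOn (fun t => Real.cos (s₀.im * Real.log t) * φ t) (Ioi 0) := by
    refine Integrable.bdd_mul (c := 1) ?_ ?_ ?_
    · exact (φ.continuous.integrable_of_hasCompactSupport φ.hasCompactSupport).integrableOn
    · exact (Real.measurable_cos.comp
        (measurable_const.mul Real.measurable_log)).aestronglyMeasurable
    · exact Eventually.of_forall fun t => by simpa using Real.abs_cos_le_one _
  have : 0 < ∫ t in Ioi (0 : ℝ), Real.cos (s₀.im * Real.log t) * φ t := by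
    rw [setIntegral_pos_iff_support_of_nonneg_ae (Eventually.of_forall hnn) hInt]
    have hsub : Metric.ball (1 : ℝ) (ε / 2) ⊆
        Function.support (fun t => Real.cos (s₀.im * Real.log t) * φ t) ∩ Ioi 0 := by
      intro t ht
      rw [Metric.mem_ball, Real.dist_eq] at ht
      constructor
      · rw [Function.mem_support]
        refine (mul_pos (hpos (by rw [Real.dist_eq]; linarith)) ?_).ne'
        exact φ.pos_of_mem_ball (by rw [Metric.mem_ball, Real.dist_eq]; show |t - 1| < ε; linarith)
      · have := (abs_lt.1 ht).1
        show 0 < t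
        linarith
    exact lt_of_lt_of_le (Metric.measure_ball_pos _ _ (by linarith)) (measure_mono hsub)
  exact this.ne' hre

variable {g : ℝ → ℝ} {a : ℕ → ℝ}

theorem locallyIntegrableOn_remainder {H : ℝ → ℂ} (hH : ContinuousOn H (Ioi 0)) (κ : ℂ) :
    LocallyIntegrableOn
      (fun t => H t - κ • (Ioc 0 1).indicator (fun t : ℝ => (t : ℂ) ^ (-1 : ℂ)) t) (Ioi 0) := by
  have h1 := hH.locallyIntegrableOn (μ := volume) measurableSet_Ioi
  have h2 : LocallyIntegrableOn (fun t : ℝ => (t : ℂ) ^ (-1 : ℂ)) (Ioi 0) := by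
    refine ContinuousOn.locallyIntegrableOn (fun t ht => ?_) measurableSet_Ioi
    exact (Complex.continuousAt_ofReal_cpow_const _ _ (Or.inr (ne_of_gt ht))).continuousWithinAt
  have h3 : LocallyIntegrableOn
      (fun t => κ • (Ioc 0 1).indicator (fun t : ℝ => (t : ℂ) ^ (-1 : ℂ)) t) (Ioi 0) :=
    fun x hx => (h2 x hx).imp fun u ⟨hu, hi⟩ => ⟨hu, (hi.indicator measurableSet_Ioc).smul κ⟩
  exact h1.sub h3

theorem exists_analyticAt_of_testFunction {H : ℝ → ℂ} (hH : ContinuousOn H (Ioi 0))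
    (hH2 : ∀ t, 2 < t → H t = 0) {θ κ M : ℝ} (hθ : 0 < θ)
    (hM : ∀ t, 0 < t → t ≤ 1 → ‖H t - κ / t‖ ≤ M * t ^ (θ - 1)) {s₀ : ℂ} (hs₀ : s₀.re = 1) :
    ∃ Φ : ℂ → ℂ, AnalyticAt ℂ Φ s₀ ∧ ∀ s, 1 < s.re → Φ s = (s - 1) * mellin H s := by
  set I : ℝ → ℂ := (Ioc 0 1).indicator (fun t : ℝ => (t : ℂ) ^ (-1 : ℂ)) with hI
  set R : ℝ → ℂ := fun t => H t - (κ : ℂ) • I t with hR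
  have hloc : LocallyIntegrableOn R (Ioi 0) := locallyIntegrableOn_remainder hH κ
  have htop : ∀ b : ℝ, R =O[atTop] (fun t : ℝ => t ^ (-b)) := fun b => by
    refine EventuallyEq.trans_isBigO (f₂ := fun _ => (0 : ℂ)) ?_ (isBigO_zero _ _)
    filter_upwards [eventually_gt_atTop 2] with y hy
    have : y ∉ Ioc (0 : ℝ) 1 := fun h => by linarith [h.2]
    simp [hR, hI, hH2 y hy, indicator_of_notMem this]
  have hbot : R =O[𝓝[>] 0] (fun t : ℝ => t ^ (-(1 - θ))) := by
    refine IsBigO.of_bound M ?_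
    filter_upwards [Ioc_mem_nhdsGT (zero_lt_one' ℝ)] with t ht
    have h1 := hM t ht.1 ht.2
    rw [Real.norm_of_nonneg (Real.rpow_nonneg ht.1.le _), neg_sub]
    convert! h1 using 3
    simp only [hI, indicator_of_mem ht, smul_eq_mul, Complex.cpow_neg_one, div_eq_mul_inv]
  have hconv : ∀ s : ℂ, 1 < s.re → MellinConvergent R s := fun s hs =>
    mellinConvergent_of_isBigO_rpow hloc (htop (s.re + 1)) (by linarith) hbot (by linarith)
  have hdiff : ∀ s : ℂ, 1 - θ < s.re → DifferentiableAt ℂ (mellin R) s := fun s hs =>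
    mellin_differentiableAt_of_isBigO_rpow hloc (htop (s.re + 1)) (by linarith) hbot hs
  refine ⟨fun s => (s - 1) * mellin R s + κ, ?_, ?_⟩
  · refine DifferentiableOn.analyticAt (s := {s : ℂ | 1 - θ < s.re}) (fun s hs => ?_)
      ((isOpen_lt continuous_const Complex.continuous_re).mem_nhds (by
        show 1 - θ < s₀.re; linarith))
    have := hdiff s hs
    exact DifferentiableAt.differentiableWithinAt (by fun_prop)
  · intro s hs
    have hIm := hasMellin_cpow_Ioc (-1) (s := s) (by simp; linarith)
    have hκ := hasMellin_const_smul hIm.1 (κ : ℂ)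
    have hadd := hasMellin_add (hconv s hs) hκ.1
    have e : (fun t => R t + (κ : ℂ) • (Ioc 0 1).indicator (fun t : ℝ => (t : ℂ) ^ (-1 : ℂ)) t) =
        H := by
      funext t; simp [hR, hI]
    rw [e] at hadd
    rw [hadd.2, hκ.2, hIm.2]
    have : s - 1 ≠ 0 := fun h => by
      rw [sub_eq_zero.1 h] at hs; simp at hs
    rw [smul_eq_mul, ← sub_eq_add_neg]
    field_simp

theorem exists_analyticAt_eq_sub_one_mul_LSeries
    (hs : ∀ s : ℂ, 1 < s.re → LSeriesSummable (fun n => (a n : ℂ)) s) {θ : ℝ} (hθ : 0 < θ)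
    (hest : ∀ g : ℝ → ℝ, ContDiff ℝ 1 g → (∀ y, y < 1 / 2 → g y = 0) → (∀ y, 2 < y → g y = 0) →
      ∃ κ M : ℝ, ∀ x : ℝ, 1 ≤ x →
        |∑' n : ℕ, a n * g (n / x) - κ * x| ≤ M * x ^ (1 - θ)) {s₀ : ℂ} (hs₀ : s₀.re = 1) :
    ∃ Φ : ℂ → ℂ, AnalyticAt ℂ Φ s₀ ∧
      ∀ᶠ s in 𝓝 s₀, 1 < s.re → Φ s = (s - 1) * LSeries (fun n => (a n : ℂ)) s := by
  obtain ⟨g, hg, hg0, hg2, hne⟩ := exists_testFunction s₀ hs₀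
  obtain ⟨κ, M, hM⟩ := hest g hg hg0 hg2
  have hG := differentiable_mellin_of_support hg.continuous hg0 hg2
  obtain ⟨Φ, hΦ, h⟩ := exists_analyticAt_of_testFunction
    (H := fun t => ((∑' n : ℕ, a n * g (n * t) : ℝ) : ℂ))
    (Complex.continuous_ofReal.comp_continuousOn (continuousOn_tsum hg.continuous hg2))
    (fun t ht => by
      have : ∑' n : ℕ, a n * g (n * t) = 0 := by
        rw [tsum_eq_sum_of_lt hg2 (N := 1) (by simpa using ht) (by linarith)]
        simp [hg0 0 (by norm_num)]
      simp only [this, Complex.ofReal_zero]) hθ (κ := κ) (M := M) (fun t ht ht1 => by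
      have h1 := hM t⁻¹ ((one_le_inv₀ ht).2 ht1)
      rw [Real.inv_rpow ht.le, ← Real.rpow_neg ht.le, neg_sub] at h1
      simp only [div_inv_eq_mul] at h1
      rw [← Complex.ofReal_div, ← Complex.ofReal_sub, Complex.norm_real, Real.norm_eq_abs,
        div_eq_mul_inv]
      exact h1) hs₀
  refine ⟨fun s => Φ s / mellin (fun t => (g t : ℂ)) s, hΦ.div (hG.analyticAt s₀) hne, ?_⟩
  filter_upwards [(hG s₀).continuousAt.eventually_ne hne] with s hs1 hs2
  rw [h s hs2, mellin_tsum_eq hg.continuous hg0 hg2 (hs s hs2)]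
  field_simp

end MellinContinuation

namespace DedekindZeta
open Filter Set Topology Asymptotics NumberField Ideal UniqueFactorizationMonoid IsDedekindDomain
open scoped nonZeroDivisors

variable (K : Type*) [Field K] [NumberField K]

/-- The number of ideals of norm `n` in the ring of integers of `K`. -/
noncomputable def idealCount (n : ℕ) : ℕ := Nat.card {I : Ideal (𝓞 K) // absNorm I = n}

theorem dedekindZeta_eq : dedekindZeta K = LSeries (fun n => (idealCount K n : ℂ)) := rfl

theorem sum_idealCount (n : ℕ) : ∑ k ∈ Finset.Icc 1 n, (idealCount K k : ℝ) =
    Nat.card {I : (Ideal (𝓞 K))⁰ // absNorm (I : Ideal (𝓞 K)) ≤ (n : ℝ)} := by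
  simp only [Nat.cast_le, ← Nat.cast_sum, idealCount]
  congr
  rw [← add_left_inj 1, ← card_norm_le_eq_card_norm_le_add_one,
    show Finset.Icc 1 n = Finset.Ioc 0 n from Finset.Icc_succ_left_eq_Ioc _ _,
    show 1 = Nat.card {I : Ideal (𝓞 K) // absNorm I = 0} by simp [Ideal.absNorm_eq_zero_iff],
    Finset.sum_Ioc_add_eq_sum_Icc (n.zero_le),
    ← Finset.card_preimage_eq_sum_card_image_eq (fun k _ ↦ finite_setOfPred_absNorm_eq k)]
  simp [Set.coe_eq_subtype]

theorem summable_idealCount {s : ℂ} (hs : 1 < s.re) :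
    LSeriesSummable (fun n => (idealCount K n : ℂ)) s := by
  have := LSeriesSummable_of_sum_norm_bigO_and_nonneg (f := fun n => (idealCount K n : ℝ))
    (r := 1) ?_ (fun _ => Nat.cast_nonneg _) zero_le_one hs
  · simpa using this
  · have h := ((NumberField.Ideal.tendsto_norm_le_div_atTop₀ K).comp
      tendsto_natCast_atTop_atTop).isBigO_one ℝ
    have h2 := h.mul (isBigO_refl (fun n : ℕ => (n : ℝ)) atTop)
    simp only [Function.comp_apply, one_mul] at h2
    refine (h2.congr' ?_ ?_)
    · filter_upwards [eventually_gt_atTop 0] with n hn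
      rw [sum_idealCount, div_mul_cancel₀]
      exact_mod_cast hn.ne'
    · exact Eventually.of_forall fun n => by simp

theorem abscissa_le : LSeries.abscissaOfAbsConv (fun n => (idealCount K n : ℂ)) ≤ 1 := by
  have := LSeries.abscissaOfAbsConv_le_of_forall_lt_LSeriesSummable (x := 1)
    (f := fun n => (idealCount K n : ℂ)) fun y hy => summable_idealCount K (by simpa using hy)
  simpa using this

variable {K}

theorem abscissa_lt {s : ℂ} (hs : 1 < s.re) :
    LSeries.abscissaOfAbsConv (fun n => (idealCount K n : ℂ)) < s.re :=
  (abscissa_le K).trans_lt (by exact_mod_cast hs)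

theorem summable_and_hasSum_absNorm {c : ℕ → ℂ} (hc : Summable fun n => idealCount K n * ‖c n‖) :
    Summable (fun I : Ideal (𝓞 K) => ‖c (absNorm I)‖) ∧
      HasSum (fun I : Ideal (𝓞 K) => c (absNorm I)) (∑' n, idealCount K n * c n) := by
  have hfib : ∀ n, Finite {I : Ideal (𝓞 K) // absNorm I = n} := fun n =>
    (finite_setOfPred_absNorm_eq n).to_subtype
  have h1 : Summable (fun I : Ideal (𝓞 K) => ‖c (absNorm I)‖) := by
    rw [← (Equiv.sigmaFiberEquiv (absNorm : Ideal (𝓞 K) → ℕ)).summable_iff,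
      summable_sigma_of_nonneg (f := (fun I => ‖c (absNorm I)‖) ∘
        ⇑(Equiv.sigmaFiberEquiv (absNorm : Ideal (𝓞 K) → ℕ))) (fun _ => norm_nonneg _)]
    refine ⟨fun n => Summable.of_finite, hc.congr fun n => ?_⟩
    have : ∀ I : {I : Ideal (𝓞 K) // absNorm I = n}, ‖c (absNorm (I : Ideal (𝓞 K)))‖ = ‖c n‖ :=
      fun I => by rw [I.2]
    simp [Equiv.sigmaFiberEquiv, this, tsum_const, idealCount]
  refine ⟨h1, ?_⟩
  rw [← (Equiv.sigmaFiberEquiv (absNorm : Ideal (𝓞 K) → ℕ)).hasSum_iff]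
  have h2 : Summable (fun n => (idealCount K n : ℂ) * c n) := .of_norm (by simpa using hc)
  refine HasSum.sigma_of_hasSum h2.hasSum (fun n => ?_)
    ((Equiv.sigmaFiberEquiv (absNorm : Ideal (𝓞 K) → ℕ)).summable_iff.2 h1.of_norm)
  have : ∀ I : {I : Ideal (𝓞 K) // absNorm I = n}, c (absNorm (I : Ideal (𝓞 K))) = c n :=
      fun I => by rw [I.2]
  have h3 : Summable fun _ : {I : Ideal (𝓞 K) // absNorm I = n} => c n := Summable.of_finite
  have := h3.hasSum
  rw [tsum_const, nsmul_eq_mul] at this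
  convert! this using 2 with I
  simp [Equiv.sigmaFiberEquiv, I.2]

theorem term_eq {f : ℕ → ℂ} {s : ℂ} (hs : s ≠ 0) (n : ℕ) :
    LSeries.term f s n = f n * (n : ℂ) ^ (-s) := by
  rcases eq_or_ne n 0 with rfl | hn
  · simp [hs]
  · rw [LSeries.term_of_ne_zero hn, Complex.cpow_neg, div_eq_mul_inv]

theorem hasSum_dedekindZeta {s : ℂ} (hs : 1 < s.re) :
    Summable (fun I : Ideal (𝓞 K) => ‖(absNorm I : ℂ) ^ (-s)‖) ∧
      HasSum (fun I : Ideal (𝓞 K) => (absNorm I : ℂ) ^ (-s)) (dedekindZeta K s) := by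
  have h0 : s ≠ 0 := fun h => by simp [h] at hs; linarith
  have h1 := (summable_idealCount K hs).norm
  simp only [term_eq h0] at h1
  have := summable_and_hasSum_absNorm (K := K) (c := fun n => (n : ℂ) ^ (-s)) (by simpa using h1)
  refine ⟨this.1, ?_⟩
  convert! this.2 using 1
  rw [dedekindZeta_eq, LSeries]
  simp only [term_eq h0]

theorem hasSum_log_dedekindZeta {s : ℂ} (hs : 1 < s.re) :
    Summable (fun I : Ideal (𝓞 K) => Real.log (absNorm I) * ‖(absNorm I : ℂ) ^ (-s)‖) ∧
      HasSum (fun I : Ideal (𝓞 K) => (Real.log (absNorm I) : ℂ) * (absNorm I : ℂ) ^ (-s))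
        (-deriv (dedekindZeta K) s) := by
  have h0 : s ≠ 0 := fun h => by simp [h] at hs; linarith
  have hsum := LSeriesSummable_logMul_of_lt_re (abscissa_lt (K := K) hs)
  have h1 := hsum.norm
  simp only [term_eq h0, LSeries.logMul] at h1
  have hl : ∀ n : ℕ, ‖(Real.log n : ℂ)‖ = Real.log n := fun n => by
    rw [Complex.norm_real, Real.norm_of_nonneg (Real.log_natCast_nonneg n)]
  have := summable_and_hasSum_absNorm (K := K) (c := fun n => (Real.log n : ℂ) * (n : ℂ) ^ (-s))
    (h1.congr fun n => by
      rw [norm_mul, norm_mul, norm_mul, ← Complex.natCast_log, Complex.norm_natCast]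
      ring)
  constructor
  · simpa only [norm_mul, hl] using this.1
  · convert! this.2 using 1
    rw [dedekindZeta_eq, LSeries_deriv (abscissa_lt (K := K) hs), neg_neg, LSeries]
    simp only [term_eq h0, LSeries.logMul, Complex.natCast_log]
    congr 1; funext n; ring

end DedekindZeta

namespace DedekindZeta
open Filter Set Topology Asymptotics NumberField Ideal UniqueFactorizationMonoid IsDedekindDomain

variable {K : Type*} [Field K] [NumberField K]

theorem count_mul (v w : HeightOneSpectrum (𝓞 K)) {J : Ideal (𝓞 K)} (hJ : J ≠ 0) :
    (normalizedFactors (w.asIdeal * J)).count v.asIdeal =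
      (if v = w then 1 else 0) + (normalizedFactors J).count v.asIdeal := by
  have hw : w.asIdeal ≠ 0 := w.ne_bot
  rw [normalizedFactors_mul hw hJ, Multiset.count_add,
    normalizedFactors_irreducible w.irreducible, normalize_eq, Multiset.count_singleton]
  simp only [HeightOneSpectrum.ext_iff]

theorem normalizedFactors_bot : normalizedFactors (⊥ : Ideal (𝓞 K)) = 0 := normalizedFactors_zero

theorem one_lt_absNorm (v : HeightOneSpectrum (𝓞 K)) : 1 < absNorm v.asIdeal := by
  have h0 : absNorm v.asIdeal ≠ 0 := absNorm_eq_zero_iff.not.2 v.ne_bot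
  have h1 : absNorm v.asIdeal ≠ 1 := absNorm_eq_one_iff.not.2 v.isPrime.ne_top
  omega

theorem hasSum_count_mul_log {I : Ideal (𝓞 K)} (hI : I ≠ 0) :
    HasSum (fun v : HeightOneSpectrum (𝓞 K) =>
      ((normalizedFactors I).count v.asIdeal : ℝ) * Real.log (absNorm v.asIdeal))
      (Real.log (absNorm I)) := by
  induction I using induction_on_prime with
  | h₁ => exact absurd rfl hI
  | h₂ I hu =>
    rw [Ideal.isUnit_iff.1 hu]
    have : normalizedFactors (⊤ : Ideal (𝓞 K)) = 0 := by
      rw [← one_eq_top]; exact normalizedFactors_one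
    simp [this]
  | h₃ J p hJ hp ih =>
    let w : HeightOneSpectrum (𝓞 K) := ⟨p, isPrime_of_prime hp, hp.ne_zero⟩
    have h1 := (hasSum_ite_eq w (Real.log (absNorm w.asIdeal))).add (ih hJ)
    have hp0 : absNorm p ≠ 0 := absNorm_eq_zero_iff.not.2 hp.ne_zero
    have hJ0 : absNorm J ≠ 0 := absNorm_eq_zero_iff.not.2 hJ
    rw [map_mul, Nat.cast_mul, Real.log_mul (by exact_mod_cast hp0) (by exact_mod_cast hJ0)]
    convert! h1 using 2 with v
    have : p = w.asIdeal := rfl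
    rw [this, count_mul v w hJ]
    split_ifs with h
    · rw [h]; push_cast; ring
    · simp

theorem count_mul_log_le {I : Ideal (𝓞 K)} (v : HeightOneSpectrum (𝓞 K)) :
    ((normalizedFactors I).count v.asIdeal : ℝ) * Real.log (absNorm v.asIdeal) ≤
      Real.log (absNorm I) := by
  rcases eq_or_ne I 0 with rfl | hI
  · simp [normalizedFactors_bot]
  · exact le_hasSum (hasSum_count_mul_log hI) v fun w _ =>
      mul_nonneg (Nat.cast_nonneg _) (Real.log_natCast_nonneg _)

theorem hasSum_count_mul_cpow (v : HeightOneSpectrum (𝓞 K)) {s : ℂ} (hs : 1 < s.re) :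
    HasSum (fun I : Ideal (𝓞 K) => ((normalizedFactors I).count v.asIdeal : ℂ) *
      (absNorm I : ℂ) ^ (-s)) (dedekindZeta K s / ((absNorm v.asIdeal : ℂ) ^ s - 1)) := by
  have h0 : -s ≠ 0 := fun h => by
    rw [neg_eq_zero] at h; simp [h] at hs; linarith
  set q := absNorm v.asIdeal with hq
  have hq1 : 1 < q := one_lt_absNorm v
  have hq1' : (1 : ℝ) < q := by exact_mod_cast hq1
  have hlog : 0 < Real.log q := Real.log_pos hq1'
  set f : Ideal (𝓞 K) → ℂ := fun I => ((normalizedFactors I).count v.asIdeal : ℂ) *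
      (absNorm I : ℂ) ^ (-s) with hf
  have hsum : Summable f := by
    refine Summable.of_norm_bounded
      ((hasSum_log_dedekindZeta (K := K) hs).1.mul_left (Real.log q)⁻¹) fun I => ?_
    rw [hf]
    simp only [norm_mul, Complex.norm_natCast]
    rw [← mul_assoc]
    refine mul_le_mul_of_nonneg_right ?_ (norm_nonneg _)
    rw [inv_mul_eq_div, le_div_iff₀ hlog]
    exact count_mul_log_le v
  have hinj : Function.Injective fun J : Ideal (𝓞 K) => v.asIdeal * J := fun J J' h =>
    mul_left_cancel₀ v.ne_bot h
  have hsup : ∀ I, I ∉ range (fun J : Ideal (𝓞 K) => v.asIdeal * J) → f I = 0 := by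
    intro I hI
    have : (normalizedFactors I).count v.asIdeal = 0 := by
      rw [Multiset.count_eq_zero]
      intro hmem
      obtain ⟨J, hJ⟩ := dvd_of_mem_normalizedFactors hmem
      exact hI ⟨J, hJ.symm⟩
    simp [hf, this]
  have h1 := (hinj.hasSum_iff hsup).2 hsum.hasSum
  have h2 := ((hasSum_dedekindZeta (K := K) hs).2.add hsum.hasSum).mul_left ((q : ℂ) ^ (-s))
  have h3 : f ∘ (fun J : Ideal (𝓞 K) => v.asIdeal * J) =
      fun J => (q : ℂ) ^ (-s) * ((absNorm J : ℂ) ^ (-s) + f J) := by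
    funext J
    rcases eq_or_ne J 0 with rfl | hJ
    · simp [hf, h0]
    · simp only [hf, Function.comp_apply]
      rw [count_mul v v hJ, map_mul, Nat.cast_mul, Complex.natCast_mul_natCast_cpow, if_pos rfl]
      push_cast
      ring
  rw [h3] at h1
  have h4 := h1.unique h2
  have hqs : ‖(q : ℂ) ^ s‖ = (q : ℝ) ^ s.re := Complex.norm_natCast_cpow_of_pos (by omega) s
  have hgt : 1 < ‖(q : ℂ) ^ s‖ := by
    rw [hqs]; exact Real.one_lt_rpow hq1' (by linarith)
  have hne : (q : ℂ) ^ s - 1 ≠ 0 := fun h => by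
    rw [sub_eq_zero.1 h] at hgt; simp at hgt
  have hne0 : (q : ℂ) ^ s ≠ 0 := fun h => by rw [h] at hgt; simp at hgt; linarith
  convert! hsum.hasSum using 1
  rw [div_eq_iff hne]
  rw [Complex.cpow_neg] at h4
  field_simp at h4
  linear_combination -h4

theorem hasSum_neg_deriv_dedekindZeta {s : ℂ} (hs : 1 < s.re) :
    HasSum (fun v : HeightOneSpectrum (𝓞 K) =>
      dedekindZeta K s * (Real.log (absNorm v.asIdeal) / ((absNorm v.asIdeal : ℂ) ^ s - 1)))
      (-deriv (dedekindZeta K) s) := by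
  have h0 : -s ≠ 0 := fun h => by
    rw [neg_eq_zero] at h; simp [h] at hs; linarith
  set F : Ideal (𝓞 K) × HeightOneSpectrum (𝓞 K) → ℂ := fun x =>
    (((normalizedFactors x.1).count x.2.asIdeal : ℝ) * Real.log (absNorm x.2.asIdeal) : ℝ) *
      (absNorm x.1 : ℂ) ^ (-s) with hF
  obtain ⟨hL1, hL2⟩ := hasSum_log_dedekindZeta (K := K) hs
  have hnorm : ∀ x, ‖F x‖ = ((normalizedFactors x.1).count x.2.asIdeal : ℝ) *
      Real.log (absNorm x.2.asIdeal) * ‖(absNorm x.1 : ℂ) ^ (-s)‖ := fun x => by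
    rw [hF]
    simp only [norm_mul]
    rw [Complex.norm_real, Real.norm_of_nonneg
      (mul_nonneg (Nat.cast_nonneg _) (Real.log_natCast_nonneg _))]
  have hrow : ∀ I : Ideal (𝓞 K), HasSum (fun v => ‖F (I, v)‖)
      (Real.log (absNorm I) * ‖(absNorm I : ℂ) ^ (-s)‖) := by
    intro I
    simp only [hnorm]
    rcases eq_or_ne I 0 with rfl | hI
    · simp only [zero_eq_bot, normalizedFactors_bot, Multiset.count_zero, Nat.cast_zero, zero_mul,
        absNorm_bot, Real.log_zero]
      exact hasSum_zero
    · exact (hasSum_count_mul_log hI).mul_right _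
  have hrow' : ∀ I : Ideal (𝓞 K), HasSum (fun v => F (I, v))
      ((Real.log (absNorm I) : ℂ) * (absNorm I : ℂ) ^ (-s)) := by
    intro I
    rcases eq_or_ne I 0 with rfl | hI
    · simp only [hF, zero_eq_bot, normalizedFactors_bot, Multiset.count_zero, Nat.cast_zero,
        zero_mul, absNorm_bot, Real.log_zero, Complex.ofReal_zero]
      exact hasSum_zero
    · have := (Complex.hasSum_ofReal.2 (hasSum_count_mul_log hI)).mul_right
        ((absNorm I : ℂ) ^ (-s))
      exact this
  have hsum : Summable F := by
    refine Summable.of_norm ((summable_prod_of_nonneg fun _ => norm_nonneg _).2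
      ⟨fun I => (hrow I).summable, hL1.congr fun I => (hrow I).tsum_eq.symm⟩)
  have htot : HasSum F (-deriv (dedekindZeta K) s) := by
    have := (hsum.hasSum.prod_fiberwise hrow').unique hL2
    rw [← this]; exact hsum.hasSum
  refine ((Equiv.prodComm _ _).hasSum_iff.2 htot).prod_fiberwise fun v => ?_
  have := (hasSum_count_mul_cpow v hs).mul_left (Real.log (absNorm v.asIdeal) : ℂ)
  convert! this using 1
  · funext I
    simp only [hF, Function.comp_apply, Equiv.prodComm_apply, Prod.swap_prod_mk]
    push_cast; ring
  · ring

end DedekindZeta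

namespace DedekindZeta
open NumberField Ideal Module

theorem card_ringHom_eq_idealCount (K : Type*) [Field K] [NumberField K] {p : ℕ} (hp : p.Prime) :
    Nat.card (𝓞 K →+* ZMod p) = idealCount K p := by
  have : Fact p.Prime := ⟨hp⟩
  refine Nat.card_congr (Equiv.ofBijective (fun φ : 𝓞 K →+* ZMod p =>
    (⟨RingHom.ker φ, ?_⟩ : {I : Ideal (𝓞 K) // absNorm I = p})) ⟨?_, ?_⟩)
  · have e := RingHom.quotientKerEquivOfSurjective (ZMod.ringHom_surjective φ)
    rw [absNorm_apply, Submodule.cardQuot_apply, Nat.card_congr e.toEquiv, Nat.card_zmod]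
  · intro φ ψ h
    have hker : RingHom.ker φ = RingHom.ker ψ := congrArg Subtype.val h
    ext1 x
    obtain ⟨n, hn⟩ := ZMod.natCast_zmod_surjective (φ x)
    have hx : x - n ∈ RingHom.ker φ := by simp [RingHom.mem_ker, hn]
    rw [hker, RingHom.mem_ker, map_sub, map_natCast, hn, sub_eq_zero] at hx
    exact hx.symm
  · rintro ⟨I, hI⟩
    have hc : Nat.card (𝓞 K ⧸ I) = p := by
      rw [← hI, absNorm_apply, Submodule.cardQuot_apply]
    have : Finite (𝓞 K ⧸ I) := Nat.finite_of_card_ne_zero (hc ▸ hp.ne_zero)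
    have := Fintype.ofFinite (𝓞 K ⧸ I)
    rw [Nat.card_eq_fintype_card] at hc
    let e := ZMod.ringEquivOfPrime (𝓞 K ⧸ I) hp hc
    refine ⟨(e.symm : 𝓞 K ⧸ I →+* ZMod p).comp (Ideal.Quotient.mk I), Subtype.ext ?_⟩
    ext x
    simp [RingHom.mem_ker, Ideal.Quotient.eq_zero_iff_mem]

variable (F : Type*) [Field F] [NumberField F]

theorem ncard_primesOver_mul [IsGalois ℚ F] {p : ℕ} (hp : p.Prime) :
    (primesOver (span {(p : ℤ)}) (𝓞 F)).ncard * (ramificationIdxIn (span {(p : ℤ)}) (𝓞 F) *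
      inertiaDegIn (span {(p : ℤ)}) (𝓞 F)) = finrank ℚ F := by
  have : Fact p.Prime := ⟨hp⟩
  rw [ncard_primesOver_mul_ramificationIdxIn_mul_inertiaDegIn _ (𝓞 F) Gal(F/ℚ),
    IsGalois.card_aut_eq_finrank]

theorem finite_primesOver_span (p : ℕ) :
    (primesOver (span {(p : ℤ)}) (𝓞 F)).Finite :=
  Algebra.QuasiFinite.finite_primesOver _

theorem ncard_primesOver_le [IsGalois ℚ F] {p : ℕ} (hp : p.Prime) :
    (primesOver (span {(p : ℤ)}) (𝓞 F)).ncard ≤ finrank ℚ F :=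
  Nat.le_of_dvd finrank_pos ⟨_, (ncard_primesOver_mul F hp).symm⟩

variable {F}

theorem isPrime_of_absNorm_eq {p : ℕ} (hp : p.Prime) {I : Ideal (𝓞 F)} (hI : absNorm I = p) :
    I.IsPrime := by
  apply isPrime_of_irreducible_absNorm
  rw [hI]; exact hp

theorem liesOver_of_absNorm_eq {p : ℕ} (hp : p.Prime) {I : Ideal (𝓞 F)} (hI : absNorm I = p) :
    I.LiesOver (span {(p : ℤ)}) := by
  have := isPrime_of_absNorm_eq hp hI
  rw [liesOver_span_iff this.ne_top (Nat.prime_iff_prime_int.1 hp)]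
  simpa [hI] using absNorm_mem I

theorem idealCount_eq_finrank_or_zero [IsGalois ℚ F] {p : ℕ} (hp : p.Prime)
    (hd : ¬ (p : ℤ) ∣ discr F) :
    idealCount F p = 0 ∨ idealCount F p = finrank ℚ F := by
  have : Fact p.Prime := ⟨hp⟩
  by_cases h : ∃ I : Ideal (𝓞 F), absNorm I = p
  · right
    obtain ⟨I, hI⟩ := h
    have h1 := isPrime_of_absNorm_eq hp hI
    have h2 := liesOver_of_absNorm_eq hp hI
    have hunr := (not_dvd_discr_iff_isUnramifiedIn F (𝓞 F) (Nat.prime_iff_prime_int.1 hp)).1 hd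
    have he : ramificationIdxIn (span {(p : ℤ)}) (𝓞 F) = 1 := by
      rw [ramificationIdxIn_eq_ramificationIdx _ I Gal(F/ℚ)]
      exact hunr.ramificationIdx_eq_one h2
    have hf : inertiaDegIn (span {(p : ℤ)}) (𝓞 F) = 1 := by
      rw [inertiaDegIn_eq_inertiaDeg _ I Gal(F/ℚ)]
      have := pow_inertiaDeg p I
      rw [hI] at this
      exact Nat.pow_right_injective hp.two_le (by simpa using this)
    have key := ncard_primesOver_mul F hp
    rw [he, hf, mul_one, mul_one] at key
    rw [← key, idealCount, ← Nat.card_coe_set_eq]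
    refine Nat.card_congr (Equiv.subtypeEquivRight fun J => ⟨fun hJ =>
      ⟨isPrime_of_absNorm_eq hp hJ, liesOver_of_absNorm_eq hp hJ⟩, fun hJ => ?_⟩)
    obtain ⟨hJ1, hJ2⟩ := hJ
    have := pow_inertiaDeg p J
    rw [← inertiaDegIn_eq_inertiaDeg (span {(p : ℤ)}) J Gal(F/ℚ), hf, pow_one] at this
    exact this.symm
  · left
    rw [idealCount, Nat.card_eq_zero]
    exact Or.inl ⟨fun I => h ⟨I.1, I.2⟩⟩

theorem idealCount_eq_ite_splitsCompletely [IsGalois ℚ F] {p : ℕ} (hp : p.Prime)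
    (hd : ¬ (p : ℤ) ∣ discr F) :
    idealCount F p = if SplitsCompletely F p then finrank ℚ F else 0 := by
  have h : SplitsCompletely F p ↔ idealCount F p = finrank ℚ F := by
    rw [← card_ringHom_eq_idealCount F hp]; rfl
  rcases idealCount_eq_finrank_or_zero hp hd with h0 | h0 <;> simp [h, h0]

end DedekindZeta

namespace DedekindZeta
open Filter Set Topology NumberField Ideal Module IsDedekindDomain

variable {F : Type*} [Field F]

/-- The rational prime below a nonzero prime ideal. -/
noncomputable def primeBelow (v : HeightOneSpectrum (𝓞 F)) : ℕ := absNorm (under ℤ v.asIdeal)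

theorem prime_primeBelow (v : HeightOneSpectrum (𝓞 F)) : (primeBelow v).Prime := by
  have : NeZero v.asIdeal := ⟨v.ne_bot⟩
  exact Nat.absNorm_under_prime v.asIdeal

theorem asIdeal_mem_primesOver (v : HeightOneSpectrum (𝓞 F)) :
    v.asIdeal ∈ primesOver (span {(primeBelow v : ℤ)}) (𝓞 F) :=
  ⟨v.isPrime, Int.liesOver_span_absNorm v.asIdeal⟩

variable [NumberField F]

theorem summable_comp_primeBelow [IsGalois ℚ F] {g : ℕ → ℝ} (hg0 : ∀ n, 0 ≤ g n)
    (hg : Summable g) : Summable fun v : HeightOneSpectrum (𝓞 F) => g (primeBelow v) := by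
  refine summable_of_sum_le (c := finrank ℚ F * ∑' n, g n) (fun v => hg0 _) fun S => ?_
  rw [Finset.sum_comp g primeBelow]
  have hcard : ∀ n, (S.filter fun v => primeBelow v = n).card ≤ finrank ℚ F := by
    intro n
    by_cases hn : n.Prime
    · refine le_trans ?_ (ncard_primesOver_le F hn)
      rw [← Set.ncard_coe_finset]
      refine Set.ncard_le_ncard_of_injOn (fun v => v.asIdeal) (fun v hv => ?_)
        (fun v _ w _ h => HeightOneSpectrum.ext h) (finite_primesOver_span F n)
      have hv' : primeBelow v = n := by simpa using (Finset.mem_filter.1 hv).2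
      exact hv' ▸ asIdeal_mem_primesOver v
    · rw [Finset.filter_false_of_mem fun v _ (h : primeBelow v = n) => hn (h ▸ prime_primeBelow v)]
      simp
  calc ∑ b ∈ S.image primeBelow, (S.filter fun v => primeBelow v = b).card • g b
      ≤ ∑ b ∈ S.image primeBelow, (finrank ℚ F : ℝ) * g b := by
        refine Finset.sum_le_sum fun b _ => ?_
        rw [nsmul_eq_mul]
        exact mul_le_mul_of_nonneg_right (by exact_mod_cast hcard b) (hg0 b)
    _ = finrank ℚ F * ∑ b ∈ S.image primeBelow, g b := by rw [Finset.mul_sum]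
    _ ≤ _ := by
        gcongr
        exact hg.sum_le_tsum _ fun n _ => hg0 n

/-- The difference between the term at `v` of the logarithmic derivative of the Euler product
and its part at prime ideals of degree one. -/
noncomputable def eulerRemainder (v : HeightOneSpectrum (𝓞 F)) (s : ℂ) : ℂ :=
  Real.log (absNorm v.asIdeal) / ((absNorm v.asIdeal : ℂ) ^ s - 1) -
    if (absNorm v.asIdeal).Prime then
      (Real.log (absNorm v.asIdeal) : ℂ) * (absNorm v.asIdeal : ℂ) ^ (-s) else 0

theorem half_le_norm_natCast_cpow_sub_one {N : ℕ} (hN : 1 < N) {s : ℂ} (hs : 1 ≤ s.re) :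
    (N : ℝ) ≤ ‖(N : ℂ) ^ s‖ ∧ (N : ℝ) / 2 ≤ ‖(N : ℂ) ^ s - 1‖ := by
  have h1 : (N : ℝ) ≤ ‖(N : ℂ) ^ s‖ := by
    rw [Complex.norm_natCast_cpow_of_pos (by lia)]
    calc (N : ℝ) = (N : ℝ) ^ (1 : ℝ) := (Real.rpow_one _).symm
      _ ≤ _ := Real.rpow_le_rpow_of_exponent_le (by exact_mod_cast hN.le) hs
  refine ⟨h1, ?_⟩
  have h2 := norm_sub_norm_le ((N : ℂ) ^ s) 1
  have h3 : (2 : ℝ) ≤ N := by exact_mod_cast hN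
  rw [norm_one] at h2
  linarith

theorem exists_pow_eq_absNorm (v : HeightOneSpectrum (𝓞 F)) :
    ∃ f, absNorm v.asIdeal = primeBelow v ^ f := by
  have := v.isPrime
  have : v.asIdeal.LiesOver (span {(primeBelow v : ℤ)}) := (asIdeal_mem_primesOver v).2
  exact ⟨_, (pow_inertiaDeg (primeBelow v) v.asIdeal).symm⟩

theorem norm_eulerRemainder_le (v : HeightOneSpectrum (𝓞 F)) {s : ℂ} (hs : 1 ≤ s.re) :
    ‖eulerRemainder v s‖ ≤ 8 * (primeBelow v : ℝ) ^ (-(3 / 2) : ℝ) := by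
  have hN := one_lt_absNorm v
  have hp := prime_primeBelow v
  obtain ⟨f, hf⟩ := exists_pow_eq_absNorm v
  obtain ⟨h1, h2⟩ := half_le_norm_natCast_cpow_sub_one hN hs
  have hp0 : (0 : ℝ) < primeBelow v := by exact_mod_cast hp.pos
  rw [eulerRemainder]
  set N := absNorm v.asIdeal
  set p := primeBelow v
  clear_value N p
  have hN0 : (0 : ℝ) < N := by exact_mod_cast hN.le
  have hlog : 0 ≤ Real.log N := Real.log_natCast_nonneg N
  have hb : ‖(N : ℂ) ^ s - 1‖ ≠ 0 := by linarith
  have ha : ‖(N : ℂ) ^ s‖ ≠ 0 := by linarith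
  have hl : ‖(Real.log N : ℂ)‖ = Real.log N := by rw [Complex.norm_real, Real.norm_of_nonneg hlog]
  split_ifs with hprime
  · have hNp : N = p := by
      rw [hf] at hprime ⊢
      rw [Nat.Prime.eq_one_of_pow hprime, pow_one]
    have heq : (Real.log N : ℂ) / ((N : ℂ) ^ s - 1) - Real.log N * (N : ℂ) ^ (-s) =
        Real.log N / ((N : ℂ) ^ s * ((N : ℂ) ^ s - 1)) := by
      rw [norm_ne_zero_iff] at ha hb
      rw [Complex.cpow_neg]
      field_simp
      ring
    rw [heq, norm_div, norm_mul, hl]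
    calc Real.log N / (‖(N : ℂ) ^ s‖ * ‖(N : ℂ) ^ s - 1‖)
        ≤ ((N : ℝ) ^ (1 / 2 : ℝ) / (1 / 2)) / (N * (N / 2)) := by
          gcongr
          exact Real.log_le_rpow_div hN0.le (by norm_num)
      _ = 4 * ((N : ℝ) ^ (1 / 2 : ℝ) / N ^ (2 : ℝ)) := by
          rw [Real.rpow_two]; field_simp; norm_num
      _ = 4 * (p : ℝ) ^ (-(3 / 2) : ℝ) := by
          rw [← Real.rpow_sub hN0, hNp]; norm_num
      _ ≤ _ := by gcongr; norm_num
  · have hf2 : 2 ≤ f := by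
      by_contra! h
      interval_cases f
      · simp [hf] at hN
      · exact hprime (by rwa [hf, pow_one])
    rw [sub_zero, norm_div, hl]
    have hNp : (p : ℝ) ^ 2 ≤ N := by
      rw [hf]; push_cast
      exact pow_le_pow_right₀ (by exact_mod_cast hp.one_le) hf2
    calc Real.log N / ‖(N : ℂ) ^ s - 1‖ ≤ ((N : ℝ) ^ (1 / 4 : ℝ) / (1 / 4)) / (N / 2) := by
          gcongr
          exact Real.log_le_rpow_div hN0.le (by norm_num)
      _ = 8 * ((N : ℝ) ^ (1 / 4 : ℝ) / N ^ (1 : ℝ)) := by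
          rw [Real.rpow_one]; field_simp; norm_num
      _ = 8 * (N : ℝ) ^ (-(3 / 4) : ℝ) := by
          rw [← Real.rpow_sub hN0]; norm_num
      _ ≤ 8 * ((p : ℝ) ^ 2) ^ (-(3 / 4) : ℝ) := by
          gcongr 8 * ?_
          exact Real.rpow_le_rpow_of_nonpos (by positivity) hNp (by norm_num)
      _ = _ := by
          rw [← Real.rpow_two, ← Real.rpow_mul hp0.le]; norm_num

theorem summable_bound_eulerRemainder [IsGalois ℚ F] :
    Summable fun v : HeightOneSpectrum (𝓞 F) => 8 * (primeBelow v : ℝ) ^ (-(3 / 2) : ℝ) :=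
  (summable_comp_primeBelow (g := fun n : ℕ => (n : ℝ) ^ (-(3 / 2) : ℝ))
    (fun n => by positivity) (Real.summable_nat_rpow.2 (by norm_num))).mul_left 8

theorem continuousOn_tsum_eulerRemainder [IsGalois ℚ F] :
    ContinuousOn (fun s => ∑' v : HeightOneSpectrum (𝓞 F), eulerRemainder v s)
      {s : ℂ | 1 ≤ s.re} := by
  refine continuousOn_tsum (fun v => ?_) summable_bound_eulerRemainder
    fun v s hs => norm_eulerRemainder_le v hs
  have hN := one_lt_absNorm v
  have hN0 : (absNorm v.asIdeal : ℂ) ≠ 0 := by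
    exact_mod_cast (zero_lt_one.trans hN).ne'
  have hc : Continuous fun s : ℂ => (absNorm v.asIdeal : ℂ) ^ s :=
    continuous_id.const_cpow (Or.inl hN0)
  refine ContinuousOn.sub (continuousOn_const.div (hc.sub continuous_const).continuousOn
    fun s hs h => ?_) ?_
  · have := (half_le_norm_natCast_cpow_sub_one hN hs).2
    rw [h, norm_zero] at this
    have h3 : (1 : ℝ) < absNorm v.asIdeal := by exact_mod_cast hN
    linarith
  · split_ifs
    · exact (continuous_const.mul (hc.comp continuous_neg)).continuousOn
    · exact continuousOn_const

end DedekindZeta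

namespace DedekindZeta
open Filter Set Topology NumberField Ideal Module IsDedekindDomain

/-- The logarithm on completely split primes, zero elsewhere. -/
noncomputable def splitLog (F : Type*) [Field F] [Algebra ℚ F] (n : ℕ) : ℝ :=
  if n.Prime ∧ SplitsCompletely F n then Real.log n else 0

theorem splitLog_nonneg (F : Type*) [Field F] [Algebra ℚ F] (n : ℕ) : 0 ≤ splitLog F n := by
  rw [splitLog]; split_ifs
  · exact Real.log_natCast_nonneg n
  · exact le_rfl

theorem sum_splitLog_le (F : Type*) [Field F] [Algebra ℚ F] (n : ℕ) :
    ∑ k ∈ Finset.Icc 1 n, splitLog F k ≤ Real.log 4 * n := by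
  have h := Chebyshev.theta_le_log4_mul_x (x := n) (Nat.cast_nonneg n)
  refine le_trans ?_ h
  rw [Chebyshev.theta_eq_sum_Icc, Nat.floor_natCast, Finset.sum_filter]
  refine (Finset.sum_le_sum fun k _ => ?_).trans
    (Finset.sum_le_sum_of_subset_of_nonneg (Finset.Icc_subset_Icc_left zero_le_one)
      fun k _ _ => ?_)
  · rw [splitLog]
    by_cases hk : k.Prime
    · simp only [hk, true_and, if_true]
      split_ifs
      · exact le_rfl
      · exact Real.log_natCast_nonneg k
    · simp [hk]
  · split_ifs
    · exact Real.log_natCast_nonneg k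
    · exact le_rfl

theorem summable_splitLog (F : Type*) [Field F] [Algebra ℚ F] {s : ℂ} (hs : 1 < s.re) :
    LSeriesSummable (fun n => (splitLog F n : ℂ)) s := by
  refine LSeriesSummable_of_sum_norm_bigO_and_nonneg (f := splitLog F)
    (r := 1) ?_ (splitLog_nonneg F) zero_le_one hs
  refine Asymptotics.IsBigO.of_bound (Real.log 4) (Eventually.of_forall fun n => ?_)
  rw [Real.norm_of_nonneg (Finset.sum_nonneg fun k _ => splitLog_nonneg F k), Real.rpow_one,
    Real.norm_of_nonneg (Nat.cast_nonneg n)]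
  exact sum_splitLog_le F n

variable {F : Type*} [Field F] [NumberField F]

theorem hasSum_primes_of_degree_one {s : ℂ} (hs : 1 < s.re) :
    HasSum (fun v : HeightOneSpectrum (𝓞 F) => if (absNorm v.asIdeal).Prime then
      (Real.log (absNorm v.asIdeal) : ℂ) * (absNorm v.asIdeal : ℂ) ^ (-s) else 0)
      (∑' n : ℕ, (idealCount F n : ℂ) *
        if n.Prime then (Real.log n : ℂ) * (n : ℂ) ^ (-s) else 0) ∧
    Summable fun n : ℕ => (idealCount F n : ℂ) *
        if n.Prime then (Real.log n : ℂ) * (n : ℂ) ^ (-s) else 0 := by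
  have h0 : s ≠ 0 := fun h => by simp [h] at hs; linarith
  set c : ℕ → ℂ := fun n => if n.Prime then (Real.log n : ℂ) * (n : ℂ) ^ (-s) else 0 with hc
  have h1 := (LSeriesSummable_logMul_of_lt_re (abscissa_lt (K := F) hs)).norm
  simp only [term_eq h0, LSeries.logMul] at h1
  have hsum : Summable fun n => idealCount F n * ‖c n‖ := by
    refine Summable.of_nonneg_of_le (fun n => by positivity) (fun n => ?_) h1
    rw [norm_mul, norm_mul, Complex.norm_natCast, ← Complex.natCast_log, hc]
    dsimp only
    split_ifs
    · rw [norm_mul]; exact le_of_eq (by ring)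
    · rw [norm_zero, mul_zero]; positivity
  refine ⟨?_, Summable.of_norm (hsum.congr fun n => by rw [norm_mul, Complex.norm_natCast])⟩
  have h2 := (summable_and_hasSum_absNorm hsum).2
  have hinj : Function.Injective fun v : HeightOneSpectrum (𝓞 F) => v.asIdeal :=
    fun v w h => HeightOneSpectrum.ext h
  refine (hinj.hasSum_iff (f := fun I : Ideal (𝓞 F) => c (absNorm I)) fun I hI => ?_).2 h2
  rw [hc]
  dsimp only
  rw [if_neg]
  intro hp
  refine hI ⟨⟨I, isPrime_of_absNorm_eq hp rfl, fun h => ?_⟩, rfl⟩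
  rw [h, absNorm_bot] at hp
  exact Nat.not_prime_zero hp

theorem exists_neg_deriv_dedekindZeta_eq [IsGalois ℚ F] : ∃ E : ℂ → ℂ,
    ContinuousOn E {s : ℂ | 1 ≤ s.re} ∧ ∀ s : ℂ, 1 < s.re →
      -deriv (dedekindZeta F) s =
        dedekindZeta F s * (finrank ℚ F * LSeries (fun n => (splitLog F n : ℂ)) s + E s) := by
  set T := (discr F).natAbs.primeFactors with hT
  set b : ℕ → ℂ := fun p =>
    (idealCount F p - (if SplitsCompletely F p then finrank ℚ F else 0 : ℕ) : ℂ) * Real.log p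
  refine ⟨fun s => (∑' v : HeightOneSpectrum (𝓞 F), eulerRemainder v s) +
    ∑ p ∈ T, b p * (p : ℂ) ^ (-s), ?_, fun s hs => ?_⟩
  · refine continuousOn_tsum_eulerRemainder.add (Continuous.continuousOn ?_)
    refine continuous_finsetSum _ fun p hp => continuous_const.mul ?_
    exact continuous_neg.const_cpow
      (Or.inl (by exact_mod_cast (Nat.prime_of_mem_primeFactors hp).ne_zero))
  · have h0 : s ≠ 0 := fun h => by simp [h] at hs; linarith
    obtain ⟨hP1, hP2⟩ := hasSum_primes_of_degree_one (F := F) hs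
    have hE : Summable fun v : HeightOneSpectrum (𝓞 F) => eulerRemainder v s :=
      Summable.of_norm_bounded summable_bound_eulerRemainder
        fun v => norm_eulerRemainder_le v hs.le
    have h1 := (hE.hasSum.add hP1).mul_left (dedekindZeta F s)
    have h2 : -deriv (dedekindZeta F) s = _ :=
      (hasSum_neg_deriv_dedekindZeta (K := F) hs).unique (by
        convert! h1 using 2 with v
        rw [eulerRemainder, sub_add_cancel])
    rw [h2]
    congr 1
    have h3 : HasSum (fun n : ℕ => finrank ℚ F * ((splitLog F n : ℂ) * (n : ℂ) ^ (-s)))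
        (finrank ℚ F * LSeries (fun n => (splitLog F n : ℂ)) s) := by
      have := (summable_splitLog F hs).LSeriesHasSum.mul_left (finrank ℚ F : ℂ)
      simpa only [term_eq h0] using this
    have h4 : HasSum (fun n : ℕ => if n ∈ T then b n * (n : ℂ) ^ (-s) else 0)
        (∑ p ∈ T, b p * (p : ℂ) ^ (-s)) := by
      have := hasSum_sum_of_ne_finset_zero (s := T) (L := .unconditional _)
        (f := fun n : ℕ => if n ∈ T then b n * (n : ℂ) ^ (-s) else 0) fun n hn => if_neg hn
      rwa [Finset.sum_congr rfl fun n hn => if_pos hn] at this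
    have h5 := hP2.hasSum.unique (by
      convert! h3.add h4 using 2 with n
      by_cases hn : n.Prime
      · have hmem : n ∈ T ↔ (n : ℤ) ∣ discr F := by
          rw [hT, Nat.mem_primeFactors, Int.natCast_dvd]
          simp [hn, discr_ne_zero]
        by_cases hd : (n : ℤ) ∣ discr F
        · rw [if_pos hn, if_pos (hmem.2 hd), splitLog]
          by_cases hsp : SplitsCompletely F n <;> simp [b, hn, hsp] <;> ring
        · rw [if_pos hn, if_neg (hd ∘ hmem.1), splitLog, idealCount_eq_ite_splitsCompletely hn hd]
          by_cases hsp : SplitsCompletely F n <;> simp [hn, hsp]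
      · have hmem : n ∉ T := fun h => hn (Nat.prime_of_mem_primeFactors h)
        simp [hn, hmem, splitLog])
    rw [h5]
    ring

end DedekindZeta

namespace LineOneNonvanishing
open Filter Set Topology

theorem re_three_add_four_add_one_nonneg {c : ℕ → ℝ} (hc : ∀ n, 0 ≤ c n)
    (hs : ∀ s : ℂ, 1 < s.re → LSeriesSummable (fun n => (c n : ℂ)) s) {σ : ℝ} (hσ : 1 < σ)
    (t : ℝ) :
    0 ≤ (3 * LSeries (fun n => (c n : ℂ)) σ +
      4 * LSeries (fun n => (c n : ℂ)) (σ + t * Complex.I) +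
      LSeries (fun n => (c n : ℂ)) (σ + (2 * t : ℝ) * Complex.I)).re := by
  have h0 := (hs σ (by simpa using hσ)).LSeriesHasSum
  have h1 := (hs (σ + t * Complex.I) (by simpa using hσ)).LSeriesHasSum
  have h2 := (hs (σ + (2 * t : ℝ) * Complex.I) (by simpa using hσ)).LSeriesHasSum
  refine (Complex.hasSum_re (((h0.mul_left 3).add (h1.mul_left 4)).add h2)).nonneg fun n => ?_
  rcases Nat.eq_zero_or_pos n with rfl | hn
  · simp
  have hn0 : (n : ℂ) ≠ 0 := by exact_mod_cast hn.ne'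
  set z : ℂ := (n : ℂ) ^ (-(t * Complex.I)) with hz
  have hz1 : ‖z‖ = 1 := by rw [hz, Complex.norm_natCast_cpow_of_pos hn]; simp
  have hsq : z.re * z.re + z.im * z.im = 1 := by
    rw [← Complex.normSq_apply, Complex.normSq_eq_norm_sq, hz1, one_pow]
  set r : ℝ := c n * (n : ℝ) ^ (-σ)
  have hr : 0 ≤ r := mul_nonneg (hc n) (by positivity)
  have hterm : ∀ w : ℂ, LSeries.term (fun n => (c n : ℂ)) (σ + w) n = r * (n : ℂ) ^ (-w) := by
    intro w
    rw [LSeries.term_of_ne_zero hn.ne', div_eq_mul_inv, ← Complex.cpow_neg, neg_add,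
      Complex.cpow_add _ _ hn0]
    simp only [r]
    push_cast
    rw [Complex.ofReal_cpow (Nat.cast_nonneg n)]
    push_cast
    ring
  have e0 := hterm 0
  rw [add_zero, neg_zero, Complex.cpow_zero, mul_one] at e0
  have e2 : (n : ℂ) ^ (-((2 * t : ℝ) * Complex.I)) = z * z := by
    rw [hz, ← Complex.cpow_add _ _ hn0]
    congr 1
    push_cast; ring
  rw [e0, hterm, hterm, e2, ← hz]
  have : 3 * (r : ℂ) + 4 * (r * z) + r * (z * z) = r * (3 + 4 * z + z * z) := by ring
  rw [this, Complex.re_ofReal_mul]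
  refine mul_nonneg hr ?_
  simp only [Complex.add_re, Complex.mul_re, Complex.re_ofNat, Complex.im_ofNat, zero_mul,
    sub_zero]
  nlinarith [sq_nonneg (1 + z.re)]

theorem tendsto_vertical_approach (t : ℝ) :
    Tendsto (fun σ : ℝ => (σ : ℂ) + t * Complex.I) (𝓝[>] 1)
      (𝓝[{s : ℂ | 1 < s.re}] (1 + t * Complex.I)) := by
  refine tendsto_nhdsWithin_iff.2 ⟨?_, ?_⟩
  · have : Continuous fun σ : ℝ => (σ : ℂ) + t * Complex.I := by fun_prop
    simpa using (this.tendsto 1).mono_left nhdsWithin_le_nhds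
  · filter_upwards [self_mem_nhdsWithin] with σ hσ
    simpa using hσ

variable {Z T E : ℂ → ℂ} {ρ : ℂ}

theorem neBot_nhdsWithin_halfPlane {s₀ : ℂ} (hs₀ : s₀.re = 1) :
    (𝓝[{s : ℂ | 1 < s.re}] s₀).NeBot := by
  have h := (tendsto_vertical_approach s₀.im).neBot
  have : (1 : ℂ) + s₀.im * Complex.I = s₀ := by
    apply Complex.ext <;> simp [hs₀]
  rwa [this] at h

theorem not_eventually_eq_zero (hZ : AnalyticOnNhd ℂ Z {s | 1 < s.re}) (hρ : ρ ≠ 0)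
    (hres : Tendsto (fun σ : ℝ => ((σ : ℂ) - 1) * Z σ) (𝓝[>] 1) (𝓝 ρ)) {s₀ : ℂ} (hs₀ : s₀.re = 1)
    {Φ : ℂ → ℂ} (hΦ : ∀ᶠ s in 𝓝 s₀, 1 < s.re → Φ s = (s - 1) * Z s) :
    ¬ ∀ᶠ s in 𝓝 s₀, Φ s = 0 := by
  intro h0
  have := neBot_nhdsWithin_halfPlane hs₀
  have hopen : IsOpen {s : ℂ | 1 < s.re} := isOpen_lt continuous_const Complex.continuous_re
  have h1 : ∃ᶠ s in 𝓝[{s : ℂ | 1 < s.re}] s₀, ∀ᶠ w in 𝓝 s, Φ w = 0 ∧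
      (1 < w.re → Φ w = (w - 1) * Z w) :=
    ((h0.and hΦ).eventually_nhds.filter_mono nhdsWithin_le_nhds).frequently
  obtain ⟨s, hs, hs1⟩ := (h1.and_eventually self_mem_nhdsWithin).exists
  have hz : Z =ᶠ[𝓝 s] 0 := by
    filter_upwards [hs, hopen.mem_nhds hs1] with w hw hw1
    have hw1' : 1 < w.re := hw1
    have h2 := hw.2 hw1
    rw [hw.1, eq_comm, mul_eq_zero, sub_eq_zero] at h2
    refine h2.resolve_left fun h => ?_
    rw [h, Complex.one_re] at hw1'
    exact lt_irrefl _ hw1'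
  have hconv : Convex ℝ {s : ℂ | 1 < s.re} := convex_halfSpace_re_gt 1
  have hzero := hZ.eqOn_zero_of_preconnected_of_eventuallyEq_zero hconv.isPreconnected hs1 hz
  refine hρ (tendsto_nhds_unique hres (Tendsto.congr' ?_ tendsto_const_nhds))
  filter_upwards [self_mem_nhdsWithin] with σ hσ
  have : (σ : ℂ) ∈ {s : ℂ | 1 < s.re} := by simpa using hσ
  rw [hzero this]; simp

theorem exists_eventually_eq_polar_part (hZ : AnalyticOnNhd ℂ Z {s | 1 < s.re}) (hρ : ρ ≠ 0)
    (hres : Tendsto (fun σ : ℝ => ((σ : ℂ) - 1) * Z σ) (𝓝[>] 1) (𝓝 ρ))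
    (hE : ContinuousOn E {s | 1 ≤ s.re})
    (hder : ∀ s : ℂ, 1 < s.re → -deriv Z s = Z s * (T s + E s))
    {s₀ : ℂ} (hs₀ : s₀.re = 1) {Φ : ℂ → ℂ} (hΦa : AnalyticAt ℂ Φ s₀)
    (hΦ : ∀ᶠ s in 𝓝 s₀, 1 < s.re → Φ s = (s - 1) * Z s) :
    ∃ (m : ℕ) (H : ℂ → ℂ) (c : ℂ), (s₀ = 1 → m = 0) ∧
      Tendsto H (𝓝[{s | 1 < s.re}] s₀) (𝓝 c) ∧
      ∀ᶠ s in 𝓝[{s | 1 < s.re}] s₀, T s = 1 / (s - 1) - m / (s - s₀) + H s := by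
  have hne := not_eventually_eq_zero hZ hρ hres hs₀ hΦ
  obtain ⟨m, g, hg, hg0, hgΦ⟩ := hΦa.exists_eventuallyEq_pow_smul_nonzero_iff.2 hne
  have hopen : IsOpen {s : ℂ | 1 < s.re} := isOpen_lt continuous_const Complex.continuous_re
  refine ⟨m, fun s => -(deriv g s / g s) - E s, -(deriv g s₀ / g s₀) - E s₀, ?_, ?_, ?_⟩
  · rintro rfl
    by_contra hm
    have h1 : Φ 1 = 0 := by
      have := hgΦ.self_of_nhds
      simpa [hm] using this
    have h2 := tendsto_vertical_approach 0
    simp only [Complex.ofReal_zero, zero_mul, add_zero] at h2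
    have h3 := hΦa.continuousAt.tendsto.comp (h2.mono_right nhdsWithin_le_nhds)
    rw [h1] at h3
    refine hρ (tendsto_nhds_unique hres (h3.congr' ?_))
    filter_upwards [(h2.mono_right nhdsWithin_le_nhds).eventually hΦ, self_mem_nhdsWithin]
      with σ hσ h1σ
    exact hσ (by simpa using h1σ)
  · refine Tendsto.sub (Tendsto.neg ?_) ?_
    · exact ((hg.deriv.continuousAt.div hg.continuousAt hg0).tendsto).mono_left nhdsWithin_le_nhds
    · exact ((hE s₀ hs₀.ge).mono fun s (hs : 1 < s.re) => hs.le).tendsto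
  · have hgne : ∀ᶠ s in 𝓝 s₀, g s ≠ 0 := hg.continuousAt.eventually_ne hg0
    filter_upwards [(hΦ.and hgΦ).eventually_nhds.filter_mono nhdsWithin_le_nhds,
      hgne.filter_mono nhdsWithin_le_nhds, self_mem_nhdsWithin,
      hg.eventually_analyticAt.filter_mono nhdsWithin_le_nhds] with s hs hgs hs1 hga
    have hs1' : 1 < s.re := hs1
    have hsub : s - s₀ ≠ 0 := fun h => by
      rw [sub_eq_zero.1 h, hs₀] at hs1'; exact lt_irrefl _ hs1'
    have hsub1 : s - 1 ≠ 0 := fun h => by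
      rw [sub_eq_zero.1 h, Complex.one_re] at hs1'; exact lt_irrefl _ hs1'
    have heq : (fun w => (w - 1) * Z w) =ᶠ[𝓝 s] fun w => (w - s₀) ^ m * g w := by
      filter_upwards [hs, hopen.mem_nhds hs1] with w hw hw1
      rw [← hw.1 hw1, hw.2, smul_eq_mul]
    have hval := heq.eq_of_nhds
    have hZd : HasDerivAt Z (deriv Z s) s := (hZ s hs1).differentiableAt.hasDerivAt
    have hd1 : HasDerivAt (fun w => (w - 1) * Z w) (1 * Z s + (s - 1) * deriv Z s) s :=
      ((hasDerivAt_id s).sub_const 1).mul hZd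
    have hd2 : HasDerivAt (fun w => (w - s₀) ^ m * g w)
        ((m * (s - s₀) ^ (m - 1) * 1) * g s + (s - s₀) ^ m * deriv g s) s :=
      (((hasDerivAt_id s).sub_const s₀).pow m).mul hga.differentiableAt.hasDerivAt
    have hdd := (hd1.congr_of_eventuallyEq heq.symm).unique hd2
    have hpow : (m : ℂ) * (s - s₀) ^ (m - 1) = m / (s - s₀) * (s - s₀) ^ m := by
      rcases m with _ | k
      · simp
      · rw [Nat.add_sub_cancel, pow_succ]; field_simp
    have hZs : Z s = (s - s₀) ^ m * g s / (s - 1) := by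
      rw [eq_div_iff hsub1, ← hval]; ring
    have hZ0 : Z s ≠ 0 := by
      rw [hZs]; exact div_ne_zero (mul_ne_zero (pow_ne_zero _ hsub) hgs) hsub1
    have hT : T s = -(deriv Z s) / Z s - E s := by
      rw [hder s hs1]; field_simp; ring
    have hdZ : deriv Z s = Z s * (m / (s - s₀) + deriv g s / g s - 1 / (s - 1)) := by
      have hpow0 := pow_ne_zero m hsub
      rw [mul_one, hpow] at hdd
      have : deriv Z s = ((m / (s - s₀) * (s - s₀) ^ m) * g s + (s - s₀) ^ m * deriv g s - Z s) /
          (s - 1) := by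
        rw [eq_div_iff hsub1]; linear_combination hdd
      rw [this, hZs]
      field_simp
    rw [hT, hdZ]
    field_simp
    ring

end LineOneNonvanishing

namespace LineOneNonvanishing
open Filter Set Topology

theorem tendsto_sub_one_mul_of_polar_part {T H : ℂ → ℂ} {c : ℂ} {t : ℝ} {m : ℕ}
    (hH : Tendsto H (𝓝[{s | 1 < s.re}] (1 + t * Complex.I)) (𝓝 c))
    (hT : ∀ᶠ s in 𝓝[{s : ℂ | 1 < s.re}] (1 + t * Complex.I),
      T s = 1 / (s - 1) - m / (s - (1 + t * Complex.I)) + H s) :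
    Tendsto (fun σ : ℝ => ((σ : ℂ) - 1) * T (σ + t * Complex.I)) (𝓝[>] 1)
      (𝓝 ((if t = 0 then 1 else 0) - m)) := by
  have hv := tendsto_vertical_approach t
  have h0 : Tendsto (fun σ : ℝ => (σ : ℂ) - 1) (𝓝[>] 1) (𝓝 0) := by
    have : Continuous fun σ : ℝ => (σ : ℂ) - 1 := by fun_prop
    simpa using (this.tendsto 1).mono_left nhdsWithin_le_nhds
  have h1 : Tendsto (fun σ : ℝ => ((σ : ℂ) - 1) * (1 / (σ + t * Complex.I - 1))) (𝓝[>] 1)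
      (𝓝 (if t = 0 then 1 else 0)) := by
    split_ifs with ht
    · subst ht
      refine tendsto_const_nhds.congr' ?_
      filter_upwards [self_mem_nhdsWithin] with σ hσ
      have : (σ : ℂ) - 1 ≠ 0 := by
        rw [sub_ne_zero]; exact_mod_cast (ne_of_gt hσ)
      simp [this]
    · have h2 := (hv.mono_right nhdsWithin_le_nhds).sub_const 1
      have hne : (1 : ℂ) + t * Complex.I - 1 ≠ 0 := by simp [ht]
      simpa using h0.mul (tendsto_const_nhds.div h2 hne (a := (1 : ℂ)))
  have h3 := (h1.sub_const (m : ℂ)).add (h0.mul (hH.comp hv))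
  rw [zero_mul, add_zero] at h3
  refine h3.congr' ?_
  filter_upwards [hv.eventually hT, self_mem_nhdsWithin] with σ hσ h1σ
  have : (σ : ℂ) - 1 ≠ 0 := by
    rw [sub_ne_zero]; exact_mod_cast (ne_of_gt h1σ)
  have h4 : (σ : ℂ) + t * Complex.I - (1 + t * Complex.I) = σ - 1 := by ring
  rw [hσ, h4, Function.comp_apply]
  field_simp

theorem tendsto_LSeries_sub_of_log_deriv {c : ℕ → ℝ} (hc : ∀ n, 0 ≤ c n)
    (hs : ∀ s : ℂ, 1 < s.re → LSeriesSummable (fun n => (c n : ℂ)) s) {d : ℕ} (hd : d ≠ 0)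
    {Z E : ℂ → ℂ} {ρ : ℂ}
    (hZ : AnalyticOnNhd ℂ Z {s | 1 < s.re}) (hρ : ρ ≠ 0)
    (hres : Tendsto (fun σ : ℝ => ((σ : ℂ) - 1) * Z σ) (𝓝[>] 1) (𝓝 ρ))
    (hE : ContinuousOn E {s | 1 ≤ s.re})
    (hder : ∀ s : ℂ, 1 < s.re →
      -deriv Z s = Z s * (d * LSeries (fun n => (c n : ℂ)) s + E s))
    (hΦ : ∀ s₀ : ℂ, s₀.re = 1 → ∃ Φ : ℂ → ℂ, AnalyticAt ℂ Φ s₀ ∧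
      ∀ᶠ s in 𝓝 s₀, 1 < s.re → Φ s = (s - 1) * Z s)
    {s₀ : ℂ} (hs₀ : s₀.re = 1) :
    ∃ L, Tendsto (fun s => LSeries (fun n => (c n : ℂ)) s - (1 / d : ℝ) / (s - 1))
      (𝓝[{s | 1 < s.re}] s₀) (𝓝 L) := by
  set T : ℂ → ℂ := fun s => d * LSeries (fun n => (c n : ℂ)) s with hT
  have key : ∀ t : ℝ, ∃ (m : ℕ) (H : ℂ → ℂ) (L : ℂ), (t = 0 → m = 0) ∧
      Tendsto H (𝓝[{s | 1 < s.re}] (1 + t * Complex.I)) (𝓝 L) ∧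
      ∀ᶠ s in 𝓝[{s : ℂ | 1 < s.re}] (1 + t * Complex.I),
        T s = 1 / (s - 1) - m / (s - (1 + t * Complex.I)) + H s := by
    intro t
    have hre : ((1 : ℂ) + t * Complex.I).re = 1 := by simp
    obtain ⟨Φ, h1, h2⟩ := hΦ _ hre
    obtain ⟨m, H, L, hm, hH⟩ := exists_eventually_eq_polar_part hZ hρ hres hE hder hre h1 h2
    exact ⟨m, H, L, fun ht => hm (by simp [ht]), hH⟩
  have hm0 : ∀ t : ℝ, ∃ (H : ℂ → ℂ) (L : ℂ),
      Tendsto H (𝓝[{s | 1 < s.re}] (1 + t * Complex.I)) (𝓝 L) ∧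
      ∀ᶠ s in 𝓝[{s : ℂ | 1 < s.re}] (1 + t * Complex.I), T s = 1 / (s - 1) + H s := by
    intro t
    obtain ⟨m, H, L, hm, hH, hTH⟩ := key t
    suffices m = 0 by
      subst this
      exact ⟨H, L, hH, hTH.mono fun s h => by rw [h]; simp⟩
    by_cases ht : t = 0
    · exact hm ht
    obtain ⟨m₀, H₀, L₀, hm₀, hH₀, hTH₀⟩ := key 0
    obtain ⟨m₂, H₂, L₂, -, hH₂, hTH₂⟩ := key (2 * t)
    have l0 := tendsto_sub_one_mul_of_polar_part hH₀ hTH₀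
    have l1 := tendsto_sub_one_mul_of_polar_part hH hTH
    have l2 := tendsto_sub_one_mul_of_polar_part hH₂ hTH₂
    rw [if_pos rfl, hm₀ rfl] at l0
    rw [if_neg ht] at l1
    rw [if_neg (by simpa using ht)] at l2
    have hlim := Complex.continuous_re.continuousAt.tendsto.comp
      (((l0.const_mul 3).add (l1.const_mul 4)).add l2)
    have hge := ge_of_tendsto hlim (b := 0) (by
      filter_upwards [self_mem_nhdsWithin] with σ hσ
      have h341 := re_three_add_four_add_one_nonneg hc hs hσ t
      have hpos : 0 ≤ (σ - 1) * d :=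
        mul_nonneg (sub_nonneg.2 (le_of_lt hσ)) (Nat.cast_nonneg d)
      have := mul_nonneg hpos h341
      rw [← Complex.re_ofReal_mul] at this
      refine this.trans_eq (congrArg Complex.re ?_)
      simp only [hT, Complex.ofReal_zero, zero_mul, add_zero]
      push_cast
      ring)
    have hle : (4 * m + m₂ : ℝ) ≤ 3 := by
      simp at hge
      linarith
    have : 4 * m + m₂ ≤ 3 := by exact_mod_cast hle
    lia
  obtain ⟨H, L, hH, hTH⟩ := hm0 s₀.im
  have hs₀' : (1 : ℂ) + s₀.im * Complex.I = s₀ := by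
    apply Complex.ext <;> simp [hs₀]
  rw [hs₀'] at hH hTH
  refine ⟨L / d, (hH.div_const (d : ℂ)).congr' ?_⟩
  filter_upwards [hTH] with s h
  have hd0 : (d : ℂ) ≠ 0 := by exact_mod_cast hd
  have : LSeries (fun n => (c n : ℂ)) s = (1 / (s - 1) + H s) / d := by
    rw [eq_div_iff hd0, ← h, hT]; ring
  rw [this]
  push_cast
  rw [add_div, div_right_comm]; ring

end LineOneNonvanishing

namespace DedekindZeta
open Filter Set Topology NumberField Module

variable (F : Type*) [Field F] [NumberField F]

theorem tendsto_sum_splitLog_div [IsGalois ℚ F] :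
    Tendsto (fun x : ℝ => (∑ k ∈ Finset.Icc 1 ⌊x⌋₊, splitLog F k) / x) atTop
      (𝓝 (1 / (finrank ℚ F : ℝ))) := by
  have hd : finrank ℚ F ≠ 0 := finrank_pos.ne'
  obtain ⟨E, hE, hder⟩ := exists_neg_deriv_dedekindZeta_eq (F := F)
  refine Tauberian.tendsto_sum_div_of_LSeries (splitLog_nonneg F) (sum_splitLog_le F) fun s₀ hs₀ =>
    LineOneNonvanishing.tendsto_LSeries_sub_of_log_deriv (splitLog_nonneg F)
      (fun s hs => summable_splitLog F hs) hd (Z := dedekindZeta F)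
      (ρ := (dedekindZeta_residue F : ℂ)) ?_ ?_ ?_ hE hder ?_ hs₀
  · exact (LSeries_analyticOnNhd _).mono fun s hs => abscissa_lt hs
  · exact_mod_cast (dedekindZeta_residue_pos F).ne'
  · exact tendsto_sub_one_mul_dedekindZeta_nhdsGT F
  · intro s₁ hs₁
    have := MellinContinuation.exists_analyticAt_eq_sub_one_mul_LSeries
      (a := fun n => (idealCount F n : ℝ)) (fun s hs => by simpa using summable_idealCount F hs)
      (θ := 1 / (finrank ℚ F : ℝ)) (by positivity)
      (fun g hg h0 h2 => NumberFieldTestFunction.abs_tsum_card_absNorm_sub_le F hg h0 h2) hs₁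
    simpa [dedekindZeta_eq] using this

theorem log_splitPrimeProd {C : ℝ} (hC : 1 < C) {n : ℕ}
    (hn : 1 ≤ n) :
    Real.log (splitPrimeProd F C n) = ∑ k ∈ Finset.Icc 1 ⌊C * n⌋₊, splitLog F k -
      ∑ k ∈ Finset.Icc 1 n, splitLog F k + splitLog F n := by
  have hle : n ≤ ⌊C * n⌋₊ := Nat.le_floor (by nlinarith [(Nat.cast_nonneg n : (0 : ℝ) ≤ n)])
  have h1 : Real.log (splitPrimeProd F C n) = ∑ k ∈ Finset.Icc n ⌊C * n⌋₊, splitLog F k := by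
    rw [splitPrimeProd, Real.log_prod fun p hp => by
      exact_mod_cast (Finset.mem_filter.1 hp).2.1.ne_zero]
    simp only [splitLog]
    rw [← Finset.sum_filter]
    refine Finset.sum_congr ?_ fun _ _ => rfl
    ext p
    have hCn : 0 ≤ C * n := by positivity
    simp only [Finset.mem_filter, Finset.mem_range, Finset.mem_Icc, Nat.cast_le,
      Nat.le_floor_iff hCn]
    constructor
    · rintro ⟨-, h2, h3, h4, h5⟩
      exact ⟨⟨h3, h4⟩, h2, h5⟩
    · rintro ⟨⟨h3, h4⟩, h2, h5⟩
      refine ⟨Nat.lt_succ_of_le ?_, h2, h3, h4, h5⟩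
      exact_mod_cast h4.trans (Nat.le_ceil _)
  rw [h1, ← Finset.sum_Ioc_add_eq_sum_Icc hle, add_left_inj, eq_sub_iff_add_eq', add_comm]
  have : ∀ m, Finset.Icc 1 m = Finset.Ioc 0 m := fun m => rfl
  rw [this, this, add_comm]
  exact Finset.sum_Ioc_consecutive _ (Nat.zero_le n) hle

theorem tendsto_splitLog_div : Tendsto (fun n : ℕ => splitLog F n / n) atTop (𝓝 0) := by
  have h := Real.isLittleO_log_id_atTop.tendsto_div_nhds_zero.comp tendsto_natCast_atTop_atTop
  refine squeeze_zero (fun n => div_nonneg (splitLog_nonneg F n) (Nat.cast_nonneg n))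
    (fun n => ?_) h
  simp only [Function.comp_apply, id_eq]
  gcongr
  rw [splitLog]; split_ifs
  · exact le_rfl
  · exact Real.log_natCast_nonneg n

end DedekindZeta

theorem stmt17 (F : Type*) [Field F] [NumberField F] [IsGalois ℚ F]
    (C : ℝ) (hC : 1 < C) :
    Filter.Tendsto (fun n : ℕ => Real.log (splitPrimeProd F C n) / (n : ℝ))
      Filter.atTop (nhds ((C - 1) / (Module.finrank ℚ F : ℝ))) := by
  have h := DedekindZeta.tendsto_sum_splitLog_div F
  have hC0 : 0 < C := by linarith
  have h1 := (h.comp (Filter.Tendsto.const_mul_atTop hC0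
    tendsto_natCast_atTop_atTop)).mul_const C
  have h2 := h.comp tendsto_natCast_atTop_atTop
  have h3 := (h1.sub h2).add (DedekindZeta.tendsto_splitLog_div F)
  have hlim : 1 / (Module.finrank ℚ F : ℝ) * C - 1 / (Module.finrank ℚ F : ℝ) + 0 =
      (C - 1) / (Module.finrank ℚ F : ℝ) := by ring
  rw [hlim] at h3
  refine h3.congr' ?_
  filter_upwards [Filter.eventually_ge_atTop 1] with n hn
  have hn0 : (n : ℝ) ≠ 0 := by exact_mod_cast (Nat.one_le_iff_ne_zero.1 hn)
  rw [DedekindZeta.log_splitPrimeProd F hC hn]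
  simp only [Function.comp_apply, Nat.floor_natCast]
  field_simp
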